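/- In the chapter B case 2 setting, suppose n₁ < n₂. Then S(V)^G is Gorenstein if and only if: (1) λ₁(g)^{p^{n₁}+p^{n₂}} λ(g) = 1 for all g ∈ G, in case c ≠ 0 ≠ d; (2) λ₁(g)^{p^{n₂}} λ₂(g)^{p^{n₁}} λ(g) = 1 for all g ∈ G, in case c = 0 ≠ d; (3) λ₂(g)^{p^{n₂}} λ₁(g)^{p^{n₁}} λ(g) = 1 for all g ∈ G, in case c ≠ 0 = d. -/

import Mathlib

noncomputable section
open CategoryTheory Matrix MvPolynomial

universe u

/-- A module `M` over `R` has finite injective dimension iff the Ext functors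
`Ext^i(-, M)` vanish for all sufficiently large `i`. -/
def HasFiniteInjectiveDimension (R : Type u) [CommRing R] (M : ModuleCat.{u} R) : Prop :=
  ∃ n : ℕ, ∀ (N : ModuleCat.{u} R) (i : ℕ), n < i →
    Subsingleton (((Ext R (ModuleCat.{u} R) i).obj (Opposite.op N)).obj M)

/-- A commutative ring is Gorenstein if it is Noetherian and its localization at every
prime ideal has finite injective dimension over itself. -/
def IsGorensteinRing (R : Type u) [CommRing R] : Prop :=
  IsNoetherianRing R ∧ ∀ (P : Ideal R) [P.IsPrime],
    HasFiniteInjectiveDimension (Localization.AtPrime P)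
      (ModuleCat.of (Localization.AtPrime P) (Localization.AtPrime P))

/-- The substitution action of a matrix on polynomials: `X i ↦ ∑ j, M i j • X j`. -/
def polyAct {F : Type u} [CommSemiring F] {m : ℕ} (M : Matrix (Fin m) (Fin m) F) :
    MvPolynomial (Fin m) F →ₐ[F] MvPolynomial (Fin m) F :=
  MvPolynomial.aeval fun i => ∑ j, M i j • MvPolynomial.X j

/-- The subalgebra of polynomials invariant under a set of matrices. -/
def invariantAlg {F : Type u} [CommSemiring F] {m : ℕ} (S : Set (Matrix (Fin m) (Fin m) F)) :
    Subalgebra F (MvPolynomial (Fin m) F) where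
  carrier := {f | ∀ M ∈ S, polyAct M f = f}
  mul_mem' := fun hf hg => fun M hM => by rw [_root_.map_mul, hf M hM, hg M hM]
  add_mem' := fun hf hg => fun M hM => by rw [_root_.map_add, hf M hM, hg M hM]
  algebraMap_mem' := fun r => fun M hM => (polyAct M).commutes r

/-- The invariant ring `S(V)^G` for a subgroup `G` of `SL(m, F)`, where `S(V)` is realised
as the polynomial ring `F[X 0, …, X (m-1)]`. -/
def invariantRing {F : Type u} [Field F] {m : ℕ}
    (G : Subgroup (Matrix.SpecialLinearGroup (Fin m) F)) :
    Subalgebra F (MvPolynomial (Fin m) F) :=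
  invariantAlg {M | ∃ g ∈ G, (g : Matrix (Fin m) (Fin m) F) = M}

/-- A matrix `M` is a transvection if `rank (M - 1) = 1` and `(M - 1)² = 0`. -/
def IsTransvectionMat {F : Type u} [Field F] {m : ℕ} (M : Matrix (Fin m) (Fin m) F) : Prop :=
  (M - 1).rank = 1 ∧ (M - 1) * (M - 1) = 0

/-- `T(G)`: the subgroup generated by all transvections contained in `G`. -/
def transSubgroup {F : Type u} [Field F] {m : ℕ}
    (G : Subgroup (Matrix.SpecialLinearGroup (Fin m) F)) :
    Subgroup (Matrix.SpecialLinearGroup (Fin m) F) :=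
  Subgroup.closure {g | g ∈ G ∧ IsTransvectionMat (g : Matrix (Fin m) (Fin m) F)}

/-- The unipotent upper triangular matrix `!![1,0,x; 0,1,y; 0,0,1]`: with respect to the
basis `{w₂, w₁, v}` it is the transvection `w₂ ↦ w₂ + x·v`, `w₁ ↦ w₁ + y·v`, `v ↦ v`. -/
def upperMat {F : Type u} [Field F] (x y : F) : Matrix (Fin 3) (Fin 3) F :=
  !![1, 0, x; 0, 1, y; 0, 0, 1]

open Abelian in
lemma subsingleton_ext_iff {R : Type u} [CommRing R] (N M : ModuleCat.{u} R) (n : ℕ) :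
    Subsingleton (((_root_.Ext R (ModuleCat.{u} R) (n + 1)).obj (Opposite.op N)).obj M) ↔
      Subsingleton (Abelian.Ext.{u} N M (n + 1)) := by
  let P : ProjectiveResolution N := ProjectiveResolution.of N
  have h₁ : Subsingleton (((_root_.Ext R (ModuleCat.{u} R) (n + 1)).obj (Opposite.op N)).obj M) ↔
      ∀ f : P.complex.X (n + 1) ⟶ M, P.complex.d (n + 2) (n + 1) ≫ f = 0 →
        ∃ g : P.complex.X n ⟶ M, P.complex.d (n + 1) n ≫ g = f := by
    rw [← ModuleCat.isZero_iff_subsingleton, (P.isoExt (R := R) (n + 1) M).isZero_iff,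
      ← HomologicalComplex.exactAt_iff_isZero_homology,
      HomologicalComplex.exactAt_iff' _ n (n + 1) (n + 2) (by simp) (by simp),
      ShortComplex.moduleCat_exact_iff]
    rfl
  have h₂ : Subsingleton (Abelian.Ext.{u} N M (n + 1)) ↔
      ∀ f : P.complex.X (n + 1) ⟶ M, P.complex.d (n + 2) (n + 1) ≫ f = 0 →
        ∃ g : P.complex.X n ⟶ M, P.complex.d (n + 1) n ≫ g = f := by
    refine ⟨fun _ f hf ↦ ?_, fun h ↦ subsingleton_of_forall_eq 0 fun α ↦ ?_⟩
    · exact (P.extMk_eq_zero_iff f (n + 2) rfl hf n rfl).mp (Subsingleton.elim _ _)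
    · obtain ⟨f, hf, rfl⟩ := P.extMk_surjective α (n + 2) rfl
      exact (P.extMk_eq_zero_iff f (n + 2) rfl hf n rfl).mpr (h f hf)
  rw [h₁, h₂]

lemma hasFiniteInjectiveDimension_iff {R : Type u} [CommRing R] (M : ModuleCat.{u} R) :
    HasFiniteInjectiveDimension R M ↔ ∃ n : ℕ, HasInjectiveDimensionLE M n := by
  refine exists_congr fun n ↦ ⟨fun h ↦ ?_, fun h N i hi ↦ ?_⟩
  · refine hasInjectiveDimensionLT_of_enoughProjectives _ _ fun N ↦ ?_
    exact (subsingleton_ext_iff N M n).mp (h N (n + 1) (Nat.lt_succ_self n))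
  · obtain ⟨k, rfl⟩ := Nat.exists_eq_add_of_lt hi
    exact (subsingleton_ext_iff N M (n + k)).mpr
      (HasInjectiveDimensionLT.subsingleton M (n + 1) _ (by lia) N)

lemma shortExact_moduleCat {R : Type u} [CommRing R] {A B C : Type u} [AddCommGroup A]
    [AddCommGroup B] [AddCommGroup C] [Module R A] [Module R B] [Module R C]
    (f : A →ₗ[R] B) (g : B →ₗ[R] C) (hf : Function.Injective f) (hfg : Function.Exact f g)
    (hg : Function.Surjective g) :
    (ShortComplex.mk (ModuleCat.ofHom f) (ModuleCat.ofHom g)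
      (by ext x; exact hfg.apply_apply_eq_zero x)).ShortExact := by
  have hm : Mono (ModuleCat.ofHom f) := (ModuleCat.mono_iff_injective _).mpr hf
  have he : Epi (ModuleCat.ofHom g) := (ModuleCat.epi_iff_surjective _).mpr hg
  refine ShortComplex.ShortExact.mk' ?_ hm he
  exact (ShortComplex.moduleCat_exact_iff _).mpr fun x hx ↦ (hfg x).mp hx

lemma hasProjectiveDimensionLE_zero_of_module {R : Type u} [CommRing R] (M : Type u)
    [AddCommGroup M] [Module R M] [Module.Projective R M] :
    HasProjectiveDimensionLE (ModuleCat.of R M) 0 :=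
  (projective_iff_hasProjectiveDimensionLT_one).mp
    (IsProjective.iff_projective (R := R) (P := M) |>.mp inferInstance)

namespace PolynomialModule
open Polynomial
variable {D : Type u} [CommRing D]

/-- The coefficientwise application of a linear map, as a map of modules over `D[X]`. -/
def mapPoly {M N : Type u} [AddCommGroup M] [Module D M] [AddCommGroup N] [Module D N]
    (f : M →ₗ[D] N) : PolynomialModule D M →ₗ[D[X]] PolynomialModule D N where
  toFun x := .ofCoeff D (x.coeff.mapRange f f.map_zero)
  map_add' x y := by
    apply coeff_injective
    ext n
    simp
  map_smul' p x := by
    apply coeff_injective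
    ext n
    simp [smul_apply]

@[simp]
lemma coeff_mapPoly {M N : Type u} [AddCommGroup M] [Module D M] [AddCommGroup N] [Module D N]
    (f : M →ₗ[D] N) (x : PolynomialModule D M) (n : ℕ) :
    (mapPoly f x).coeff n = f (x.coeff n) := by
  simp [mapPoly]

lemma mapPoly_single {M N : Type u} [AddCommGroup M] [Module D M] [AddCommGroup N]
    [Module D N] (f : M →ₗ[D] N) (n : ℕ) (m : M) :
    mapPoly f (single D n m) = single D n (f m) := by
  apply coeff_injective
  ext k
  simp [Finsupp.single_apply]
  split_ifs <;> simp

lemma mapPoly_exact {M N P : Type u} [AddCommGroup M] [Module D M] [AddCommGroup N]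
    [Module D N] [AddCommGroup P] [Module D P] {f : M →ₗ[D] N} {g : N →ₗ[D] P}
    (h : Function.Exact f g) (hf : Function.Injective f) :
    Function.Exact (mapPoly f) (mapPoly g) := by
  intro x
  constructor
  · intro hx
    have hx' : ∀ n, ∃ y, f y = x.coeff n := fun n ↦
      (h _).mp (by rw [← coeff_mapPoly, hx]; rfl)
    choose y hy using hx'
    have hz : ∀ n, y n ≠ 0 → n ∈ x.coeff.support := fun n hn ↦ by
      rw [Finsupp.mem_support_iff, ← hy]
      exact fun h0 ↦ hn (hf (h0.trans f.map_zero.symm))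
    refine ⟨.ofCoeff D (Finsupp.onFinset x.coeff.support y hz), ?_⟩
    apply coeff_injective
    ext n
    simp [hy]
  · rintro ⟨y, rfl⟩
    apply coeff_injective
    ext n
    simpa using h.apply_apply_eq_zero _

lemma mapPoly_injective {M N : Type u} [AddCommGroup M] [Module D M] [AddCommGroup N]
    [Module D N] {f : M →ₗ[D] N} (hf : Function.Injective f) :
    Function.Injective (mapPoly f) := by
  intro x y h
  apply coeff_injective
  ext n
  apply hf
  rw [← coeff_mapPoly, ← coeff_mapPoly, h]

lemma mapPoly_surjective {M N : Type u} [AddCommGroup M] [Module D M] [AddCommGroup N]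
    [Module D N] {f : M →ₗ[D] N} (hf : Function.Surjective f) :
    Function.Surjective (mapPoly f) := by
  intro x
  induction x using PolynomialModule.induction_linear with
  | zero => exact ⟨0, map_zero _⟩
  | add p q hp hq =>
    obtain ⟨a, rfl⟩ := hp
    obtain ⟨b, rfl⟩ := hq
    exact ⟨a + b, map_add _ _ _⟩
  | single n m =>
    obtain ⟨a, rfl⟩ := hf m
    exact ⟨single D n a, mapPoly_single f n a⟩

instance projective (M : Type u) [AddCommGroup M] [Module D M] [Module.Projective D M] :
    Module.Projective D[X] (PolynomialModule D M) :=
  Module.Projective.of_equiv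
    (PolynomialModule.polynomialTensorProductLEquivPolynomialModule D M)

lemma hasProjectiveDimensionLE (n : ℕ) (M : ModuleCat.{u} D)
    [hM : HasProjectiveDimensionLE M n] :
    HasProjectiveDimensionLE (ModuleCat.of D[X] (PolynomialModule D M)) n := by
  induction n generalizing M with
  | zero =>
    have h : Projective M := (projective_iff_hasProjectiveDimensionLT_one).mpr hM
    have h' : Module.Projective D M := (IsProjective.iff_projective (R := D) (P := M)).mpr h
    exact hasProjectiveDimensionLE_zero_of_module _
  | succ n ih =>
    let S := M.projectiveShortComplex
    have hS : S.ShortExact := M.shortExact_projectiveShortComplex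
    have hP : Module.Projective D S.X₂ := inferInstance
    have hP' : Projective S.X₂ := (IsProjective.iff_projective (R := D) (P := S.X₂)).mp hP
    have h1 : HasProjectiveDimensionLE S.X₁ n :=
      (hS.hasProjectiveDimensionLT_X₃_iff n hP').mp hM
    have h1' := ih S.X₁
    have h2' : Projective (ModuleCat.of D[X] (PolynomialModule D S.X₂)) :=
      (IsProjective.iff_projective (R := D[X]) (P := PolynomialModule D S.X₂)).mp inferInstance
    have hinj : Function.Injective S.f.hom := (ModuleCat.mono_iff_injective _).mp hS.mono_f
    have hsur : Function.Surjective S.g.hom := (ModuleCat.epi_iff_surjective _).mp hS.epi_g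
    have hex : Function.Exact S.f.hom S.g.hom :=
      (ShortComplex.ShortExact.moduleCat_exact_iff_function_exact S).mp hS.exact
    have hS' := shortExact_moduleCat (mapPoly S.f.hom) (mapPoly S.g.hom)
      (mapPoly_injective hinj) (mapPoly_exact hex hinj) (mapPoly_surjective hsur)
    exact (hS'.hasProjectiveDimensionLT_X₃_iff n h2').mpr h1'

section Koszul
variable (N : Type u) [AddCommGroup N] [Module D N] [Module D[X] N] [IsScalarTower D D[X] N]

/-- The evaluation map `∑ mᵢ Xⁱ ↦ ∑ Xⁱ • mᵢ`. -/
def counit : PolynomialModule D N →ₗ[D[X]] N :=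
  (LinearMap.liftBaseChange D[X] (LinearMap.id : N →ₗ[D] N)) ∘ₗ
    (polynomialTensorProductLEquivPolynomialModule D N).symm.toLinearMap

lemma counit_single (n : ℕ) (m : N) : counit N (single D n m) = (Polynomial.X ^ n : D[X]) • m := by
  have h : single D n m = (Polynomial.X ^ n : D[X]) • single D 0 m := by
    rw [← monomial_one_right_eq_X_pow, monomial_smul_single]; simp
  rw [h, LinearMap.map_smul]
  congr 1
  have : single D 0 m = polynomialTensorProductLEquivPolynomialModule D N (1 ⊗ₜ m) := by
    simp [polynomialTensorProductLEquivPolynomialModule]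
    rfl
  simp [counit, this]

/-- Multiplication by `X` as a linear map over the coefficient ring. -/
def mulX : N →ₗ[D] N := LinearMap.lsmul D[X] N X |>.restrictScalars D

/-- The difference of the two actions of `X` on `N[X]`. -/
def koszul : PolynomialModule D N →ₗ[D[X]] PolynomialModule D N :=
  LinearMap.lsmul D[X] _ X - mapPoly (mulX N)

lemma koszul_single (n : ℕ) (m : N) : koszul N (single D n m) =
    single D (n + 1) m - single D n ((X : D[X]) • m) := by
  simp only [koszul, LinearMap.sub_apply, mapPoly_single, LinearMap.lsmul_apply]
  rw [← monomial_one_one_eq_X, monomial_smul_single, one_smul, add_comm,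
    monomial_one_one_eq_X]
  rfl

lemma koszul_injective : Function.Injective (koszul (D := D) N) := by
  rw [injective_iff_map_eq_zero]
  intro x hx
  have h : ∀ n, x.coeff n = (X : D[X]) • x.coeff (n + 1) := fun n ↦ by
    have := congr_arg (fun y : PolynomialModule D N ↦ y.coeff (n + 1)) hx
    simp only [koszul, LinearMap.sub_apply, LinearMap.lsmul_apply] at this
    rw [← monomial_one_one_eq_X] at this
    have h2 : ∀ (a b : PolynomialModule D N) k, (a - b).coeff k = a.coeff k - b.coeff k :=
      fun _ _ _ ↦ rfl
    rw [h2, monomial_smul_apply, coeff_mapPoly] at this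
    simp only [le_add_iff_nonneg_left, zero_le, if_true, one_smul, add_tsub_cancel_right] at this
    rw [show (coeff (0 : PolynomialModule D N)) (n + 1) = 0 from rfl, sub_eq_zero] at this
    exact this
  have h2 : ∀ k n, x.coeff n = (Polynomial.X ^ k : D[X]) • x.coeff (n + k) := by
    intro k
    induction k with
    | zero => simp
    | succ k ih => intro n; rw [ih n, h (n + k), ← mul_smul, pow_succ]; rfl
  apply coeff_injective
  ext n
  obtain ⟨b, hb⟩ := x.coeff.support.exists_nat_subset_range
  rw [h2 b n]
  have : x.coeff (n + b) = 0 := by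
    by_contra hne
    have := Finset.mem_range.mp (hb (Finsupp.mem_support_iff.mpr hne))
    lia
  simp [this]

lemma koszul_exact : Function.Exact (koszul (D := D) N) (counit N) := by
  have key : ∀ x : PolynomialModule D N, ∃ y, x = koszul N y + single D 0 (counit N x) := by
    intro x
    induction x using PolynomialModule.induction_linear with
    | zero => exact ⟨0, by simp⟩
    | add p q hp hq =>
      obtain ⟨a, ha⟩ := hp
      obtain ⟨b, hb⟩ := hq
      refine ⟨a + b, ?_⟩
      rw [map_add, map_add, single_add, add_add_add_comm, ← ha, ← hb]
    | single n m =>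
      induction n generalizing m with
      | zero => exact ⟨0, by simp [counit_single]⟩
      | succ n ih =>
        obtain ⟨y, hy⟩ := ih ((X : D[X]) • m)
        refine ⟨single D n m + y, ?_⟩
        rw [map_add, koszul_single, counit_single, add_assoc, pow_succ, mul_smul,
          ← counit_single, ← hy]
        simp
  intro x
  constructor
  · intro hx
    obtain ⟨y, hy⟩ := key x
    exact ⟨y, by rw [hy, hx]; simp⟩
  · rintro ⟨y, rfl⟩
    induction y using PolynomialModule.induction_linear with
    | zero => simp
    | add p q hp hq => rw [map_add, map_add, hp, hq, add_zero]
    | single n m => rw [koszul_single, map_sub, counit_single, counit_single, pow_succ,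
        mul_smul, sub_self]

lemma counit_surjective : Function.Surjective (counit (D := D) N) := fun m ↦
  ⟨single D 0 m, by simp [counit_single]⟩

end Koszul
end PolynomialModule

open Polynomial in
lemma hasProjectiveDimensionLE_of_polynomial {D : Type u} [CommRing D] (n : ℕ)
    (hD : ∀ M : ModuleCat.{u} D, HasProjectiveDimensionLE M n) (N : ModuleCat.{u} D[X]) :
    HasProjectiveDimensionLE N (n + 1) := by
  let _ : Module D N := Module.compHom N (C : D →+* D[X])
  have : IsScalarTower D D[X] N := ⟨fun a b x ↦ by
    rw [Polynomial.smul_eq_C_mul, mul_smul]; rfl⟩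
  have hS := shortExact_moduleCat _ _ (PolynomialModule.koszul_injective (D := D) N)
    (PolynomialModule.koszul_exact N) (PolynomialModule.counit_surjective N)
  have := hD (ModuleCat.of D N)
  have h := PolynomialModule.hasProjectiveDimensionLE n (ModuleCat.of D N)
  exact hS.hasProjectiveDimensionLT_X₃ (n + 1) h (hasProjectiveDimensionLT_of_ge _ (n + 1) _ (by lia))

lemma hasProjectiveDimensionLE_of_ringEquiv {R S : Type u} [CommRing R] [CommRing S]
    (e : R ≃+* S) (n : ℕ) (h : ∀ M : ModuleCat.{u} R, HasProjectiveDimensionLE M n)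
    (M : ModuleCat.{u} S) : HasProjectiveDimensionLE M n := by
  let _ : Module R M := Module.compHom M (e : R →+* S)
  let _ : RingHomInvPair (e : R →+* S) (e.symm : S →+* R) := RingHomInvPair.of_ringEquiv e
  let _ : RingHomInvPair (e.symm : S →+* R) (e : R →+* S) := RingHomInvPair.of_ringEquiv e.symm
  have := h (ModuleCat.of R M)
  let e' : ModuleCat.of R M ≃ₛₗ[RingHomClass.toRingHom e] M :=
    { AddEquiv.refl M with map_smul' := fun _ _ ↦ rfl }
  exact ModuleCat.hasProjectiveDimensionLE_of_semiLinearEquiv e e' n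

lemma hasProjectiveDimensionLE_mvPolynomial {F : Type u} [Field F] (n : ℕ)
    (M : ModuleCat.{u} (MvPolynomial (Fin n) F)) : HasProjectiveDimensionLE M n := by
  induction n with
  | zero =>
    exact hasProjectiveDimensionLE_of_ringEquiv
      (MvPolynomial.isEmptyRingEquiv F (Fin 0)).symm 0
      (fun N ↦ hasProjectiveDimensionLE_zero_of_module (R := F) N) M
  | succ n ih =>
    exact hasProjectiveDimensionLE_of_ringEquiv
      (MvPolynomial.finSuccEquiv F n).symm.toRingEquiv (n + 1)
      (hasProjectiveDimensionLE_of_polynomial n ih) M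

lemma hasInjectiveDimensionLE_mvPolynomial {F : Type u} [Field F] (n : ℕ)
    (M : ModuleCat.{u} (MvPolynomial (Fin n) F)) : HasInjectiveDimensionLE M n :=
  hasInjectiveDimensionLT_of_enoughProjectives _ _ fun N ↦
    (hasProjectiveDimensionLE_mvPolynomial n N).subsingleton _ _ _ le_rfl M

lemma hasInjectiveDimensionLE_coextendScalars {C A : Type u} [CommRing C] [CommRing A]
    (f : C →+* A) (hf : Module.Projective C ((ModuleCat.restrictScalars f).obj (.of A A)))
    (n : ℕ) (M : ModuleCat.{u} C) [hM : HasInjectiveDimensionLE M n] :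
    HasInjectiveDimensionLE ((ModuleCat.coextendScalars f).obj M) n := by
  induction n generalizing M with
  | zero =>
    have h : Injective M := injective_iff_hasInjectiveDimensionLT_one.mpr hM
    exact injective_iff_hasInjectiveDimensionLT_one.mp
      (Injective.injective_of_adjoint (ModuleCat.restrictCoextendScalarsAdj f) M)
  | succ n ih =>
    have hι := Injective.ι_mono M
    let S : ShortComplex (ModuleCat.{u} C) :=
      ShortComplex.mk (Injective.ι M) (Limits.cokernel.π (Injective.ι M)) (by simp)
    have hS : S.ShortExact :=
      { exact := ShortComplex.exact_cokernel _ }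
    have h3 : HasInjectiveDimensionLE S.X₃ n :=
      (hS.hasInjectiveDimensionLT_X₃_iff n inferInstance).mpr hM
    have h3' := ih S.X₃
    have h2' := Injective.injective_of_adjoint (ModuleCat.restrictCoextendScalarsAdj f) S.X₂
    have : (ModuleCat.coextendScalars.{u, u, u} f).IsRightAdjoint :=
      (ModuleCat.restrictCoextendScalarsAdj f).isRightAdjoint
    have : Limits.PreservesFiniteLimits (ModuleCat.coextendScalars.{u, u, u} f) :=
      have := (ModuleCat.restrictCoextendScalarsAdj f).rightAdjoint_preservesLimits.{0, 0}
      Limits.PreservesLimitsOfSize.preservesFiniteLimits.{0, 0} _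
    have hS' : (S.map (ModuleCat.coextendScalars f)).ShortExact := by
      have hm : Mono S.f := hι
      refine ShortComplex.ShortExact.mk' ?_ (inferInstanceAs (Mono ((ModuleCat.coextendScalars f).map S.f))) ?_
      · exact ShortComplex.Exact.map_of_mono_of_preservesKernel hS.exact _ hm inferInstance
      · refine (ModuleCat.epi_iff_surjective _).mpr fun g ↦ ?_
        have hsur : Function.Surjective S.g.hom := (ModuleCat.epi_iff_surjective _).mp hS.epi_g
        obtain ⟨l, hl⟩ := Module.projective_lifting_property S.g.hom
          (ModuleCat.CoextendScalars.equiv f _ g) hsur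
        refine ⟨(ModuleCat.CoextendScalars.equiv f _).symm l, ?_⟩
        exact hl
    exact (hS'.hasInjectiveDimensionLT_X₃_iff n h2').mp h3'

lemma hasInjectiveDimensionLE_localization {A : Type u} [CommRing A] [IsNoetherianRing A]
    (S : Submonoid A) (n : ℕ) (h : HasInjectiveDimensionLE (ModuleCat.of A A) n) :
    HasInjectiveDimensionLE (ModuleCat.of (Localization S) (Localization S)) n := by
  have h0 := ModuleCat.localizedModule_isLocalizedModule (ModuleCat.of A A) S
  have h1 := (ModuleCat.of A A).localizedModule_hasInjectiveDimensionLE n S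
  refine (ModuleCat.hasInjectiveDimensionLE_iff_of_linearEquiv ?_ n).mp h1
  exact (IsLocalizedModule.linearEquiv S ((ModuleCat.of A A).localizedModuleMkLinearMap S)
    (Algebra.linearMap A (Localization S))).extendScalarsOfIsLocalization S (Localization S)

/-- An algebra which is finite projective over a polynomial ring and self-dual over it has finite
injective dimension over itself. -/
lemma hasInjectiveDimensionLE_of_perfectPairing {F A : Type u} [Field F] [CommRing A] (n : ℕ)
    [Algebra (MvPolynomial (Fin n) F) A] [Module.Projective (MvPolynomial (Fin n) F) A]
    (φ : A →ₗ[MvPolynomial (Fin n) F] MvPolynomial (Fin n) F)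
    (hφ : Function.Bijective fun a : A ↦ φ ∘ₗ LinearMap.mulRight (MvPolynomial (Fin n) F) a) :
    HasInjectiveDimensionLE (ModuleCat.of A A) n := by
  let C := MvPolynomial (Fin n) F
  let f : C →+* A := algebraMap C A
  have hmod : ∀ (c : C) (a : (ModuleCat.restrictScalars f).obj (.of A A)),
      c • a = (show A from c • (show A from a)) := fun c a ↦ (Algebra.smul_def c (show A from a)).symm
  let e₀ : A ≃ₗ[C] (ModuleCat.restrictScalars f).obj (.of A A) :=
    { AddEquiv.refl A with map_smul' := fun c a ↦ (hmod c a).symm }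
  have hf : Module.Projective C ((ModuleCat.restrictScalars f).obj (.of A A)) :=
    Module.Projective.of_equiv e₀
  have hC : HasInjectiveDimensionLE (ModuleCat.of C C) n :=
    hasInjectiveDimensionLE_mvPolynomial n _
  have h := hasInjectiveDimensionLE_coextendScalars f hf n (ModuleCat.of C C)
  let ψ : A →ₗ[A] (ModuleCat.coextendScalars f).obj (ModuleCat.of C C) :=
    { toFun := fun a ↦ (ModuleCat.CoextendScalars.equiv f _).symm
        ((φ ∘ₗ LinearMap.mulRight C a) ∘ₗ e₀.symm.toLinearMap)
      map_add' := fun a b ↦ ModuleCat.CoextendScalars.ext (by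
        refine LinearMap.ext fun x ↦ ?_
        exact (congrArg φ (mul_add (show A from x) a b)).trans (map_add φ _ _))
      map_smul' := fun a b ↦ ModuleCat.CoextendScalars.ext (by
        refine LinearMap.ext fun x ↦ ?_
        exact congrArg φ (mul_assoc (show A from x) a b).symm) }
  have hψ : Function.Bijective ψ := by
    constructor
    · intro a b hab
      refine hφ.1 (LinearMap.ext fun x ↦ ?_)
      exact LinearMap.congr_fun (congrArg (ModuleCat.CoextendScalars.equiv f _) hab) (e₀ x)
    · intro g
      obtain ⟨a, ha⟩ := hφ.2 ((ModuleCat.CoextendScalars.equiv f _ g) ∘ₗ e₀.toLinearMap)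
      refine ⟨a, ModuleCat.CoextendScalars.ext (LinearMap.ext fun x ↦ ?_)⟩
      exact LinearMap.congr_fun ha (e₀.symm x)
  exact (ModuleCat.hasInjectiveDimensionLE_iff_of_linearEquiv (M := ModuleCat.of A A)
    (LinearEquiv.ofBijective ψ hψ) n).mpr h

section ExtRegular
open Abelian
variable {R : Type u} [CommRing R]

lemma ext_comp_smul_id_eq_zero {K M : ModuleCat.{u} R} {x : R} (hK : ∀ k : K, x • k = 0) {i : ℕ}
    (α : Abelian.Ext.{u} K M i) : α.comp (Ext.mk₀ (x • 𝟙 M)) (add_zero i) = 0 := by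
  have h : x • 𝟙 K = 0 := by
    ext k
    exact hK k
  rw [← Ext.smul_eq_comp_mk₀, ← Ext.mk₀_id_comp α, ← Ext.smul_comp, ← Ext.mk₀_smul, h,
    Ext.mk₀_zero, Ext.zero_comp]

lemma ext_zero_eq_zero_of_isSMulRegular {K M : ModuleCat.{u} R} {x : R}
    (hM : IsSMulRegular M x) (hK : ∀ k : K, x • k = 0) (α : Abelian.Ext.{u} K M 0) : α = 0 := by
  obtain ⟨f, rfl⟩ := (Ext.mk₀_bijective K M).2 α
  have : f = 0 := by
    ext k
    refine hM ?_
    change x • f.hom k = x • (0 : M)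
    rw [← map_smul, hK, map_zero, smul_zero]
  rw [this, Ext.mk₀_zero]

lemma ext_succ_eq_zero_of_isSMulRegular {K M : ModuleCat.{u} R} {x : R}
    (hM : IsSMulRegular M x) (hK : ∀ k : K, x • k = 0) {i : ℕ}
    (h : ∀ α : Abelian.Ext.{u} K (M.smulShortComplex x).X₃ i, α = 0)
    (α : Abelian.Ext.{u} K M (i + 1)) : α = 0 := by
  obtain ⟨γ, hγ⟩ := Ext.covariant_sequence_exact₁ K hM.smulShortComplex_shortExact α
    (ext_comp_smul_id_eq_zero hK α) rfl
  rw [← hγ, h γ, Ext.zero_comp]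
  rfl

lemma ext_precomp_surjective_of_isSMulRegular {K N M : ModuleCat.{u} R} (j : K ⟶ N) {x : R}
    (hM : IsSMulRegular M x) (hN : ∀ k : N, x • k = 0) {i : ℕ}
    (hs : ∀ β : Abelian.Ext.{u} K M (i + 1), ∃ γ : Abelian.Ext.{u} N M (i + 1),
      (Ext.mk₀ j).comp γ (zero_add _) = β)
    (h0 : ∀ α : Abelian.Ext.{u} K M i, α = 0)
    (β : Abelian.Ext.{u} K (M.smulShortComplex x).X₃ i) :
    ∃ γ : Abelian.Ext.{u} N (M.smulShortComplex x).X₃ i,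
      (Ext.mk₀ j).comp γ (zero_add _) = β := by
  have hS := hM.smulShortComplex_shortExact
  obtain ⟨γ, hγ⟩ := hs (β.comp hS.extClass rfl)
  obtain ⟨β', hβ'⟩ := Ext.covariant_sequence_exact₁ N hS γ (ext_comp_smul_id_eq_zero hN γ) rfl
  refine ⟨β', ?_⟩
  obtain ⟨ε, hε⟩ := Ext.covariant_sequence_exact₃ K hS
    (β + -(Ext.mk₀ j).comp β' (zero_add _)) rfl (by
      rw [Ext.add_comp, Ext.neg_comp, add_neg_eq_zero, ← hγ, ← hβ']
      exact (Ext.comp_assoc _ _ _ _ _ (by lia)).symm)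
  have h0' : ∀ α : Abelian.Ext.{u} K (M.smulShortComplex x).X₂ i, α = 0 := h0
  rw [h0' ε, Ext.zero_comp] at hε
  exact (add_neg_eq_zero.mp hε.symm).symm

lemma hom_precomp_surjective_of_isSMulRegular {K N M : ModuleCat.{u} R} (j : K ⟶ N) {x : R}
    (hM : IsSMulRegular M x) (hN : ∀ k : N, x • k = 0)
    (hs : ∀ β : Abelian.Ext.{u} K M 1, ∃ γ : Abelian.Ext.{u} N M 1,
      (Ext.mk₀ j).comp γ (zero_add _) = β)
    (h0 : ∀ α : Abelian.Ext.{u} K M 0, α = 0) (f : K ⟶ (M.smulShortComplex x).X₃) :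
    ∃ g : N ⟶ (M.smulShortComplex x).X₃, j ≫ g = f := by
  obtain ⟨γ, hγ⟩ := ext_precomp_surjective_of_isSMulRegular j hM hN hs h0 (Ext.mk₀ f)
  obtain ⟨g, rfl⟩ := (Ext.mk₀_bijective _ _).2 γ
  exact ⟨g, (Ext.mk₀_bijective _ _).1 ((Ext.mk₀_comp_mk₀ j g).symm.trans hγ)⟩

lemma hasProjectiveDimensionLT_quotSMulTop {M : ModuleCat.{u} R} {x : R}
    (hM : IsSMulRegular M x) (n : ℕ) (h : HasProjectiveDimensionLT M n) :
    HasProjectiveDimensionLT (ModuleCat.of R (QuotSMulTop x M)) (n + 1) :=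
  hM.smulShortComplex_shortExact.hasProjectiveDimensionLT_X₃ n h
    (hasProjectiveDimensionLT_of_ge M n (n + 1) (by lia))

section
open scoped Pointwise

lemma ker_mkQ_comp_quotSMulTop {M : Type u} [AddCommGroup M] [Module R M] (f : R →ₗ[R] M)
    (hf : Function.Surjective f) (x : R) :
    ((x • (⊤ : Submodule R M)).mkQ ∘ₗ f).ker = f.ker ⊔ Ideal.span {x} := by
  have h : x • (⊤ : Submodule R M) = Submodule.map f (Ideal.span {x}) := by
    rw [← LinearMap.range_eq_top.mpr hf, LinearMap.range_eq_map, ← Submodule.map_pointwise_smul,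
      ← Submodule.ideal_span_singleton_smul, smul_eq_mul, Ideal.mul_top]
  rw [LinearMap.ker_comp, Submodule.ker_mkQ, h, Submodule.comap_map_eq, sup_comm]

lemma exists_map_sub_mul_eq_zero {M : Type u} [AddCommGroup M] [Module R M] {π : R →ₗ[R] M}
    (hπ : Function.Surjective π) (g : M →ₗ[R] M) {s₁ s₂ : R} (h : g (π s₂) = π s₁) :
    ∃ a, π (s₁ - a * s₂) = 0 := by
  obtain ⟨a, ha⟩ := hπ (g (π 1))
  have h2 : π s₂ = s₂ • π 1 := by rw [← map_smul, smul_eq_mul, mul_one]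
  refine ⟨a, ?_⟩
  rw [map_sub, ← h, h2, map_smul, ← ha, ← map_smul, smul_eq_mul, mul_comm, sub_self]

lemma exists_linearMap_range_toSpanSingleton {M : Type u} [AddCommGroup M] [Module R M] (s t : M)
    (h : ∀ a : R, a • s = 0 → a • t = 0) :
    ∃ f : (LinearMap.toSpanSingleton R M s).range →ₗ[R] M, ∀ hs, f ⟨s, hs⟩ = t := by
  have hle : (LinearMap.toSpanSingleton R M s).ker ≤ (LinearMap.toSpanSingleton R M t).ker := h
  refine ⟨(Submodule.liftQ _ _ hle) ∘ₗ
    (LinearMap.toSpanSingleton R M s).quotKerEquivRange.symm.toLinearMap, fun hs ↦ ?_⟩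
  have : (⟨s, hs⟩ : (LinearMap.toSpanSingleton R M s).range) =
      (LinearMap.toSpanSingleton R M s).quotKerEquivRange (Submodule.Quotient.mk 1) :=
    Subtype.ext (one_smul R s).symm
  rw [this, LinearMap.comp_apply, LinearEquiv.coe_coe, LinearEquiv.symm_apply_apply]
  exact one_smul R t

end

end ExtRegular

section Local
open Abelian IsLocalRing
open scoped Pointwise
variable {L : Type u} [CommRing L] [IsLocalRing L] [IsNoetherianRing L]

lemma ext_eq_zero_of_pow_maximalIdeal_smul {Y : ModuleCat.{u} L} (t : ℕ)
    (hk : ∀ α : Abelian.Ext.{u} (.of L (L ⧸ maximalIdeal L)) Y t, α = 0)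
    (N : Type u) [AddCommGroup N] [Module L N] [hN : Module.Finite L N] (r : ℕ)
    (hr : maximalIdeal L ^ r ≤ Module.annihilator L N)
    (α : Abelian.Ext.{u} (.of L N) Y t) : α = 0 := by
  induction hN using IsNoetherianRing.induction_on_isQuotientEquivQuotientPrime L with
  | subsingleton N =>
    have : Limits.IsZero (ModuleCat.of L N) := ModuleCat.isZero_of_subsingleton _
    rw [← Ext.mk₀_id_comp α, this.eq_of_src (𝟙 _) 0, Ext.mk₀_zero, Ext.zero_comp]
  | quotient N p e =>
    have hp : p.1 = maximalIdeal L := by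
      refine le_antisymm (le_maximalIdeal p.2.ne_top) (p.2.le_of_pow_le (n := r) ?_)
      rw [e.annihilator_eq, Ideal.annihilator_quotient] at hr
      exact hr
    have e' : N ≃ₗ[L] L ⧸ maximalIdeal L := e.trans (Submodule.quotEquivOfEq _ _ hp)
    rw [← Ext.mk₀_id_comp α, ← e'.toModuleIso.hom_inv_id, ← Ext.mk₀_comp_mk₀,
      Ext.comp_assoc_of_second_deg_zero, hk (Ext.comp _ α _), Ext.comp_zero]
  | exact N₁ N₂ N₃ f g hf hg hfg h₁ h₃ =>
    have hS := shortExact_moduleCat f g hf hfg hg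
    have hr₁ : maximalIdeal L ^ r ≤ Module.annihilator L N₁ :=
      hr.trans (f.annihilator_le_of_injective hf)
    have hr₃ : maximalIdeal L ^ r ≤ Module.annihilator L N₃ :=
      hr.trans (g.annihilator_le_of_surjective hg)
    obtain ⟨β, hβ⟩ := Ext.contravariant_sequence_exact₂ hS Y α (h₁ hr₁ _)
    rw [← hβ, h₃ hr₃ β, Ext.comp_zero]

lemma ext_eq_zero_of_hasProjectiveDimensionLT {Y : ModuleCat.{u} L} (n t : ℕ)
    [hY : HasInjectiveDimensionLE Y n]
    (M : Type u) [AddCommGroup M] [Module L M] [Module.Finite L M] (r : ℕ)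
    (hr : maximalIdeal L ^ r ≤ Module.annihilator L M)
    [HasProjectiveDimensionLT (ModuleCat.of L M) t]
    (s : M) (hs : s ≠ 0) (hms : ∀ a ∈ maximalIdeal L, a • s = 0)
    (N : Type u) [AddCommGroup N] [Module L N] [hN : Module.Finite L N] (r' : ℕ)
    (hr' : maximalIdeal L ^ r' ≤ Module.annihilator L N) (i : ℕ) (hi : t ≤ i)
    (α : Abelian.Ext.{u} (.of L N) Y i) : α = 0 := by
  obtain ⟨k, hk⟩ : ∃ k, n + 1 ≤ i + k := ⟨n + 1, by lia⟩
  induction k generalizing i N r' with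
  | zero => exact Ext.eq_zero_of_hasInjectiveDimensionLT α (n + 1) hk
  | succ k ih =>
    refine ext_eq_zero_of_pow_maximalIdeal_smul i (fun β ↦ ?_) N r' hr' α
    let q : (L ⧸ maximalIdeal L) →ₗ[L] M :=
      Submodule.liftQ _ (LinearMap.toSpanSingleton L M s) fun a ha ↦ hms a ha
    have hq : Function.Injective q := by
      refine LinearMap.ker_eq_bot.mp (Submodule.ker_liftQ_eq_bot _ _ _ fun a ha ↦ ?_)
      by_contra h
      have hu : IsUnit a := by simpa using h
      exact hs (hu.smul_eq_zero.mp ha)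
    have hS := shortExact_moduleCat q q.range.mkQ hq (LinearMap.exact_map_mkQ_range q)
      (Submodule.mkQ_surjective _)
    obtain ⟨γ, rfl⟩ := Ext.contravariant_sequence_exact₁ hS Y β (add_comm 1 i)
      (ih (M ⧸ q.range) r (hr.trans (q.range.mkQ.annihilator_le_of_surjective
        (Submodule.mkQ_surjective _))) (i + 1) (by lia) _ (by lia))
    rw [Ext.eq_zero_of_hasProjectiveDimensionLT γ t hi, Ext.comp_zero]

lemma exists_sub_mul_mem_of_hasInjectiveDimensionLE (n : ℕ)
    [HasInjectiveDimensionLE (ModuleCat.of L L) n] (x₁ x₂ x₃ : L)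
    (hreg : RingTheory.Sequence.IsWeaklyRegular L [x₁, x₂, x₃]) (r : ℕ)
    (hr : maximalIdeal L ^ r ≤ Ideal.span {x₁, x₂, x₃}) (s₁ s₂ : L)
    (h₁ : ∀ a ∈ maximalIdeal L, a * s₁ ∈ Ideal.span {x₁, x₂, x₃})
    (h₂ : ∀ a ∈ maximalIdeal L, a * s₂ ∈ Ideal.span {x₁, x₂, x₃})
    (hs₂ : s₂ ∉ Ideal.span {x₁, x₂, x₃}) : ∃ a, s₁ - a * s₂ ∈ Ideal.span {x₁, x₂, x₃} := by
  obtain ⟨hreg₁, hreg'⟩ := (RingTheory.Sequence.isWeaklyRegular_cons_iff _ _ _).mp hreg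
  obtain ⟨hreg₂, hreg''⟩ := (RingTheory.Sequence.isWeaklyRegular_cons_iff _ _ _).mp hreg'
  obtain ⟨hreg₃, -⟩ := (RingTheory.Sequence.isWeaklyRegular_cons_iff _ _ _).mp hreg''
  let M₁ := QuotSMulTop x₁ L
  let M₂ := QuotSMulTop x₂ M₁
  let M₃ := QuotSMulTop x₃ M₂
  obtain ⟨π, hπ, hker⟩ : ∃ π : L →ₗ[L] M₃, Function.Surjective π ∧
      π.ker = Ideal.span {x₁, x₂, x₃} := by
    refine ⟨(x₃ • (⊤ : Submodule L M₂)).mkQ ∘ₗ (x₂ • (⊤ : Submodule L M₁)).mkQ ∘ₗ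
      (x₁ • (⊤ : Submodule L L)).mkQ ∘ₗ LinearMap.id, ?_, ?_⟩
    · exact (Submodule.mkQ_surjective _).comp
        ((Submodule.mkQ_surjective _).comp (Submodule.mkQ_surjective _))
    · rw [ker_mkQ_comp_quotSMulTop _
          ((Submodule.mkQ_surjective _).comp (Submodule.mkQ_surjective _)),
        ker_mkQ_comp_quotSMulTop _ (Submodule.mkQ_surjective _),
        ker_mkQ_comp_quotSMulTop _ Function.surjective_id, LinearMap.ker_id, bot_sup_eq,
        Ideal.span_insert, Ideal.span_insert, sup_assoc]
  have hmem {a : L} : π a = 0 ↔ a ∈ Ideal.span {x₁, x₂, x₃} := by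
    rw [← hker, LinearMap.mem_ker]
  have hann {a : L} (ha : a ∈ Ideal.span {x₁, x₂, x₃}) (k : M₃) : a • k = 0 := by
    obtain ⟨b, rfl⟩ := hπ k
    rw [← map_smul, hmem]
    exact Ideal.mul_mem_right _ _ ha
  have hk₂ : ∀ a ∈ maximalIdeal L, a • π s₂ = 0 := fun a ha ↦ by
    rw [← map_smul, hmem]
    exact h₂ a ha
  have hk₁ : ∀ a ∈ maximalIdeal L, a • π s₁ = 0 := fun a ha ↦ by
    rw [← map_smul, hmem]
    exact h₁ a ha
  have hne : π s₂ ≠ 0 := fun h ↦ hs₂ (hmem.mp h)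
  let K := (LinearMap.toSpanSingleton L M₃ (π s₂)).range
  have hK {a : L} (ha : a ∈ Ideal.span {x₁, x₂, x₃}) (k : ModuleCat.of L K) : a • k = 0 :=
    Subtype.ext (hann ha _)
  have hmx₁ : x₁ ∈ Ideal.span {x₁, x₂, x₃} := Ideal.subset_span (by simp)
  have hmx₂ : x₂ ∈ Ideal.span {x₁, x₂, x₃} := Ideal.subset_span (by simp)
  have hmx₃ : x₃ ∈ Ideal.span {x₁, x₂, x₃} := Ideal.subset_span (by simp)
  have hd : HasProjectiveDimensionLT (ModuleCat.of L M₃) 4 :=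
    hasProjectiveDimensionLT_quotSMulTop (M := .of L M₂) hreg₃ 3
      (hasProjectiveDimensionLT_quotSMulTop (M := .of L M₁) hreg₂ 2
        (hasProjectiveDimensionLT_quotSMulTop (M := .of L L) hreg₁ 1
          (projective_iff_hasProjectiveDimensionLT_one.mp inferInstance)))
  have hr₃ : maximalIdeal L ^ r ≤ Module.annihilator L M₃ := fun a ha ↦
    Module.mem_annihilator.mpr (hann (hr ha))
  have hS := shortExact_moduleCat K.subtype K.mkQ K.injective_subtype
    (LinearMap.exact_subtype_mkQ K) K.mkQ_surjective
  let j : ModuleCat.of L K ⟶ ModuleCat.of L M₃ := ModuleCat.ofHom K.subtype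
  have e₃ (β : Abelian.Ext.{u} (ModuleCat.of L K) (ModuleCat.of L L) 3) :
      ∃ γ : Abelian.Ext.{u} (ModuleCat.of L M₃) (ModuleCat.of L L) 3, (Ext.mk₀ j).comp γ (zero_add _) = β :=
    Ext.contravariant_sequence_exact₁ hS _ β rfl
      (ext_eq_zero_of_hasProjectiveDimensionLT n 4 M₃ r hr₃ (π s₂) hne hk₂ (M₃ ⧸ K) r
        (hr₃.trans (K.mkQ.annihilator_le_of_surjective K.mkQ_surjective)) _ le_rfl _)
  have v₀ := ext_zero_eq_zero_of_isSMulRegular (M := .of L M₂) hreg₃ (hK hmx₃)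
  have v₁ := ext_succ_eq_zero_of_isSMulRegular (M := .of L M₁) hreg₂ (hK hmx₂) v₀
  have v₂ := ext_succ_eq_zero_of_isSMulRegular (M := .of L L) hreg₁ (hK hmx₁) v₁
  have e₂ := ext_precomp_surjective_of_isSMulRegular (M := .of L L) j hreg₁ (hann hmx₁) e₃ v₂
  have e₁ := ext_precomp_surjective_of_isSMulRegular (M := .of L M₁) j hreg₂ (hann hmx₂) e₂ v₁
  obtain ⟨f, hf⟩ := exists_linearMap_range_toSpanSingleton (R := L) (π s₂) (π s₁) fun a ha ↦ by
    refine hk₁ a ?_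
    by_contra h
    have hu : IsUnit a := by simpa using h
    exact hne (hu.smul_eq_zero.mp ha)
  obtain ⟨g, hg⟩ : ∃ g : ModuleCat.of L M₃ ⟶ ModuleCat.of L M₃, j ≫ g = ModuleCat.ofHom f :=
    hom_precomp_surjective_of_isSMulRegular (M := .of L M₂) j hreg₃ (hann hmx₃) e₁ v₀
      (ModuleCat.ofHom f)
  have hmemK : π s₂ ∈ K := ⟨1, one_smul L (π s₂)⟩
  have hgs : g.hom (π s₂) = π s₁ :=
    (DFunLike.congr_fun (congrArg ModuleCat.Hom.hom hg) (⟨π s₂, hmemK⟩ : K)).trans (hf hmemK)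
  obtain ⟨a, ha⟩ := exists_map_sub_mul_eq_zero hπ g.hom hgs
  exact ⟨a, hmem.mp ha⟩

end Local

section WeightZero
variable {F : Type u} [Field F] {n : ℕ} {Γ : Type*} [AddCommGroup Γ]

/-- The polynomials all of whose monomials have weight zero. -/
def weightZero (F : Type u) [Field F] (w : (Fin n →₀ ℕ) →+ Γ) :
    Subalgebra F (MvPolynomial (Fin n) F) where
  carrier := {f | ∀ m, coeff m f ≠ 0 → w m = 0}
  mul_mem' {f g} hf hg m hm := by
    classical
    rw [coeff_mul] at hm
    obtain ⟨x, hx, h⟩ := Finset.exists_ne_zero_of_sum_ne_zero hm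
    rw [← Finset.HasAntidiagonal.mem_antidiagonal.mp hx, map_add, hf _ (left_ne_zero_of_mul h),
      hg _ (right_ne_zero_of_mul h), add_zero]
  add_mem' {f g} hf hg m hm := by
    rw [coeff_add] at hm
    by_contra h
    rw [not_imp_comm.mp (hf m) h, not_imp_comm.mp (hg m) h, add_zero] at hm
    exact hm rfl
  algebraMap_mem' r m hm := by
    classical
    rw [algebraMap_eq, coeff_C] at hm
    rw [← (ite_ne_right_iff.mp hm).1, map_zero]

lemma monomial_mem_weightZero {w : (Fin n →₀ ℕ) →+ Γ} {m : Fin n →₀ ℕ} (hm : w m = 0) (r : F) :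
    monomial m r ∈ weightZero F w := fun k hk ↦ by
  classical
  rw [coeff_monomial] at hk
  rw [← (ite_ne_right_iff.mp hk).1, hm]

lemma map_nsmul_eq_zero_of_single {w : (Fin n →₀ ℕ) →+ Γ} {e : ℕ}
    (he : ∀ i, w (Finsupp.single i e) = 0) (m : Fin n →₀ ℕ) : w (e • m) = 0 := by
  induction m using Finsupp.induction_linear with
  | zero => simp
  | add f g hf hg => rw [smul_add, map_add, hf, hg, add_zero]
  | single i k =>
    rw [Finsupp.smul_single, smul_eq_mul, mul_comm, ← smul_eq_mul, ← Finsupp.smul_single,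
      map_nsmul, he, smul_zero]

lemma expand_mem_weightZero {w : (Fin n →₀ ℕ) →+ Γ} {e : ℕ}
    (he : ∀ i, w (Finsupp.single i e) = 0) (f : MvPolynomial (Fin n) F) :
    expand e f ∈ weightZero F w := by
  induction f using MvPolynomial.induction_on' with
  | monomial m r =>
    rw [expand_monomial]
    exact monomial_mem_weightZero (map_nsmul_eq_zero_of_single he m) r
  | add f g hf hg => exact map_add (expand e) f g ▸ add_mem hf hg

/-- The homomorphism `X i ↦ X i ^ e` into the polynomials of weight zero. -/
def expandWeightZero {w : (Fin n →₀ ℕ) →+ Γ} {e : ℕ} (he : ∀ i, w (Finsupp.single i e) = 0) :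
    MvPolynomial (Fin n) F →ₐ[F] weightZero F w :=
  (expand e).codRestrict _ (expand_mem_weightZero he)

lemma nsmul_add_injective {e : ℕ} (he : 0 < e) (b : Fin n →₀ ℕ) :
    Function.Injective fun k : Fin n →₀ ℕ ↦ e • k + b := fun x y h ↦ by
  ext i
  have := DFunLike.congr_fun (add_right_cancel h) i
  simpa [he.ne'] using this

/-- The polynomial with coefficients `k ↦ coeff (e • k + b) f`. -/
def residuePart {e : ℕ} (he : 0 < e) (b : Fin n →₀ ℕ) (f : MvPolynomial (Fin n) F) :
    MvPolynomial (Fin n) F :=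
  AddMonoidAlgebra.ofCoeff
    (Finsupp.comapDomain (fun k ↦ e • k + b) (AddMonoidAlgebra.coeff f) (nsmul_add_injective he b).injOn)

@[simp]
lemma coeff_residuePart {e : ℕ} (he : 0 < e) (b k : Fin n →₀ ℕ) (f : MvPolynomial (Fin n) F) :
    coeff k (residuePart he b f) = coeff (e • k + b) f := rfl

lemma nsmul_le_nsmul_add_iff {e : ℕ} {b : Fin n →₀ ℕ} (hb : ∀ i, b i < e) (s k : Fin n →₀ ℕ) :
    e • s ≤ e • k + b ↔ s ≤ k := by
  refine ⟨fun h i ↦ ?_, fun h i ↦ ?_⟩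
  · have h1 := h i
    have h2 := hb i
    simp only [Finsupp.coe_smul, Finsupp.coe_add, Pi.smul_apply, Pi.add_apply, smul_eq_mul] at h1
    by_contra! h3
    nlinarith
  · have := h i
    simp only [Finsupp.coe_smul, Finsupp.coe_add, Pi.smul_apply, Pi.add_apply, smul_eq_mul]
    nlinarith

lemma residuePart_expand_mul {e : ℕ} (he : 0 < e) {b : Fin n →₀ ℕ} (hb : ∀ i, b i < e)
    (c f : MvPolynomial (Fin n) F) :
    residuePart he b (expand e c * f) = c * residuePart he b f := by
  induction c using MvPolynomial.induction_on' with
  | monomial s r =>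
    ext k
    rw [expand_monomial, coeff_residuePart, coeff_monomial_mul', coeff_monomial_mul',
      coeff_residuePart]
    simp only [nsmul_le_nsmul_add_iff hb]
    refine if_ctx_congr Iff.rfl (fun h ↦ ?_) fun _ ↦ rfl
    obtain ⟨t, rfl⟩ := exists_add_of_le h
    rw [smul_add, add_assoc, add_tsub_cancel_left, add_tsub_cancel_left]
  | add p q hp hq =>
    rw [map_add, add_mul, add_mul, ← hp, ← hq]
    ext k
    simp

lemma exists_nsmul_add {e : ℕ} (he : 0 < e) (m : Fin n →₀ ℕ) :
    ∃ k b : Fin n →₀ ℕ, (∀ i, b i < e) ∧ m = e • k + b :=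
  ⟨m.mapRange (· / e) (Nat.zero_div e), m.mapRange (· % e) (Nat.zero_mod e),
    fun i ↦ by simpa using Nat.mod_lt _ he, by ext i; simp [Nat.div_add_mod]⟩

/-- The exponents of weight zero with all entries smaller than `e`. -/
def weightBox (w : (Fin n →₀ ℕ) →+ Γ) (e : ℕ) : Set (Fin n →₀ ℕ) :=
  {b | (∀ i, b i < e) ∧ w b = 0}

lemma finite_weightBox (w : (Fin n →₀ ℕ) →+ Γ) (e : ℕ) : (weightBox w e).Finite :=
  (Set.finite_Iic (Finsupp.equivFunOnFinite.symm fun _ : Fin n ↦ e)).subset fun _ hb i ↦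
    (hb.1 i).le

variable {w : (Fin n →₀ ℕ) →+ Γ} {e : ℕ} (he : 0 < e) (hw : ∀ i, w (Finsupp.single i e) = 0)

include hw in
lemma eq_zero_of_residuePart_eq_zero {f : weightZero F w}
    (hf : ∀ b ∈ weightBox w e, residuePart he b (f : MvPolynomial (Fin n) F) = 0) : f = 0 := by
  ext m
  by_contra h
  obtain ⟨k, b, hb, rfl⟩ := exists_nsmul_add he m
  have h0 := f.2 _ h
  rw [map_add, map_nsmul_eq_zero_of_single hw, zero_add] at h0
  exact h (by rw [← coeff_residuePart he, hf b ⟨hb, h0⟩]; rfl)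

variable [Algebra (MvPolynomial (Fin n) F) (weightZero F w)]
  (halg : ∀ c, (algebraMap (MvPolynomial (Fin n) F) (weightZero F w) c :
    MvPolynomial (Fin n) F) = expand e c)

/-- The residue parts of a polynomial of weight zero, as a map which is linear over the
subring of `e`-th powers. -/
def residueLinearMap {b : Fin n →₀ ℕ} (hb : ∀ i, b i < e) :
    weightZero F w →ₗ[MvPolynomial (Fin n) F] MvPolynomial (Fin n) F where
  toFun f := residuePart he b f
  map_add' f g := by ext; simp
  map_smul' c f := by
    rw [Algebra.smul_def, MulMemClass.coe_mul, halg, residuePart_expand_mul he hb]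
    rfl

lemma residuePart_monomial {b b' : Fin n →₀ ℕ} (hb' : ∀ i, b' i < e) :
    residuePart he b (monomial b' (1 : F)) = if b' = b then 1 else 0 := by
  classical
  have h (k) : b' = e • k + b ↔ k = 0 ∧ b' = b := by
    refine ⟨fun h ↦ ?_, fun h ↦ by rw [h.1, h.2, smul_zero, zero_add]⟩
    have hk : k = 0 := le_antisymm ((nsmul_le_nsmul_add_iff hb' k 0).mp
      (by rw [smul_zero, zero_add, h]; exact le_self_add)) zero_le
    rw [hk, smul_zero, zero_add] at h
    exact ⟨hk, h⟩
  ext k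
  rw [coeff_residuePart, coeff_monomial]
  simp only [h]
  by_cases h1 : b' = b <;> simp [h1, coeff_one, eq_comm]

instance (w : (Fin n →₀ ℕ) →+ Γ) (e : ℕ) : Fintype (weightBox w e) := (finite_weightBox w e).fintype

/-- The monomials with exponents in `weightBox w e` form a basis of the polynomials of weight
zero over the subring of `e`-th powers. -/
def weightZeroEquiv : weightZero F w ≃ₗ[MvPolynomial (Fin n) F]
    (weightBox w e → MvPolynomial (Fin n) F) :=
  LinearEquiv.ofBijective (LinearMap.pi fun b ↦ residueLinearMap he halg b.2.1) <| by
    classical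
    refine ⟨(injective_iff_map_eq_zero _).mpr fun f hf ↦
      eq_zero_of_residuePart_eq_zero he hw fun b hb ↦ congrFun hf ⟨b, hb⟩, fun c ↦ ?_⟩
    refine ⟨∑ b : weightBox w e, c b • ⟨monomial b.1 1, monomial_mem_weightZero b.2.2 1⟩, ?_⟩
    ext1 b
    rw [map_sum, Finset.sum_apply, Finset.sum_eq_single b]
    · rw [map_smul, Pi.smul_apply, LinearMap.pi_apply]
      change c b • residuePart he b.1 (monomial b.1 1) = _
      rw [residuePart_monomial he b.2.1, if_pos rfl, smul_eq_mul, mul_one]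
    · intro b' _ hne
      rw [map_smul, Pi.smul_apply, LinearMap.pi_apply]
      change c b' • residuePart he b.1 (monomial b'.1 1) = _
      rw [residuePart_monomial he b'.2.1, if_neg fun h ↦ hne (Subtype.ext h), smul_zero]
    · simp

lemma weightZeroEquiv_apply (f : weightZero F w) (b : weightBox w e) :
    weightZeroEquiv he hw halg f b = residuePart he b.1 (f : MvPolynomial (Fin n) F) := rfl

/-- The basis of monomials with exponents in `weightBox w e`. -/
def weightZeroBasis : Module.Basis (weightBox w e) (MvPolynomial (Fin n) F) (weightZero F w) :=
  Module.Basis.ofEquivFun (weightZeroEquiv he hw halg)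

lemma weightZeroBasis_apply (b : weightBox w e) :
    weightZeroBasis he hw halg b = ⟨monomial b.1 1, monomial_mem_weightZero b.2.2 1⟩ := by
  classical
  rw [weightZeroBasis, Module.Basis.coe_ofEquivFun, LinearEquiv.symm_apply_eq]
  ext1 b'
  rw [weightZeroEquiv_apply, residuePart_monomial he b.2.1]
  simp [Pi.single_apply, Subtype.ext_iff, eq_comm]

include he hw halg in
lemma hasInjectiveDimensionLE_weightZero (N : Fin n →₀ ℕ) (hN : ∀ i, N i + 1 = e) (hwN : w N = 0) :
    HasInjectiveDimensionLE (ModuleCat.of (weightZero F w) (weightZero F w)) n := by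
  have := Module.Projective.of_basis (weightZeroBasis he hw halg)
  have hNe (i) : N i < e := by have := hN i; lia
  have hle {b : Fin n →₀ ℕ} (hb : b ∈ weightBox w e) : b ≤ N := fun i ↦ by
    have := hN i; have := hb.1 i; lia
  have hsub {b : Fin n →₀ ℕ} (hb : b ∈ weightBox w e) : N - b ∈ weightBox w e := by
    refine ⟨fun i ↦ ?_, ?_⟩
    · have := hN i
      rw [Finsupp.tsub_apply]
      lia
    · have h : w (N - b + b) = w N := by rw [tsub_add_cancel_of_le (hle hb)]
      rwa [map_add, hb.2, add_zero, hwN] at h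
  have key {b : Fin n →₀ ℕ} (hb : b ≤ N) (f : MvPolynomial (Fin n) F) :
      residuePart he N (monomial b 1 * f) = residuePart he (N - b) f := by
    ext k
    obtain ⟨t, rfl⟩ := exists_add_of_le hb
    rw [coeff_residuePart, coeff_residuePart, add_left_comm, coeff_monomial_mul, one_mul,
      add_tsub_cancel_left]
  refine hasInjectiveDimensionLE_of_perfectPairing n (residueLinearMap he halg hNe) ⟨?_, ?_⟩
  · intro f g hfg
    rw [← sub_eq_zero]
    refine eq_zero_of_residuePart_eq_zero he hw fun b hb ↦ ?_
    have h := LinearMap.congr_fun hfg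
      ⟨monomial (N - b) 1, monomial_mem_weightZero (hsub hb).2 1⟩
    change residuePart he N (monomial (N - b) 1 * f.1) =
      residuePart he N (monomial (N - b) 1 * g.1) at h
    rw [key tsub_le_self, key tsub_le_self, tsub_tsub_cancel_of_le (hle hb)] at h
    ext k
    have := congrArg (coeff k) h
    simpa [sub_eq_zero] using this
  · intro ψ
    obtain ⟨f, hf⟩ := (weightZeroEquiv he hw halg).surjective fun b ↦
      ψ ⟨monomial (N - b.1) 1, monomial_mem_weightZero (hsub b.2).2 1⟩
    refine ⟨f, (weightZeroBasis he hw halg).ext fun b ↦ ?_⟩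
    have h := congrFun hf ⟨N - b.1, hsub b.2⟩
    rw [weightZeroEquiv_apply] at h
    rw [weightZeroBasis_apply]
    change residuePart he N (monomial b.1 1 * f.1) = _
    rw [key (hle b.2), h]
    simp only [tsub_tsub_cancel_of_le (hle b.2)]

end WeightZero

section WeightZeroSocle
variable {F : Type u} [Field F] {Γ : Type*} [AddCommGroup Γ]

lemma isWeaklyRegular_X :
    RingTheory.Sequence.IsWeaklyRegular (MvPolynomial (Fin 3) F) ([X 0, X 1, X 2] : List (MvPolynomial (Fin 3) F)) := by
  have key (s : Set (Fin 3)) (i : Fin 3) (hi : i ∉ s) :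
      IsSMulRegular (MvPolynomial (Fin 3) F ⧸
        (Ideal.span (X '' s) : Ideal (MvPolynomial (Fin 3) F))) (X i : MvPolynomial (Fin 3) F) := by
    refine (isSMulRegular_quotient_iff_mem_of_smul_mem _ _).mpr fun f hf ↦ ?_
    rw [smul_eq_mul, mem_ideal_span_X_image] at hf
    rw [mem_ideal_span_X_image]
    intro m hm
    obtain ⟨j, hj, h⟩ := hf (Finsupp.single i 1 + m) (by
      rwa [mem_support_iff, coeff_X_mul, ← mem_support_iff])
    refine ⟨j, hj, ?_⟩
    rwa [Finsupp.add_apply, Finsupp.single_eq_of_ne (by rintro rfl; exact hi hj), zero_add] at h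
  refine ⟨fun i hi ↦ ?_⟩
  have h2 : Ideal.ofList (List.take i ([X 0, X 1, X 2] : List (MvPolynomial (Fin 3) F))) •
      (⊤ : Ideal (MvPolynomial (Fin 3) F)) = Ideal.span (X '' {j : Fin 3 | j.1 < i}) := by
    rw [smul_eq_mul, Ideal.mul_top, Ideal.ofList]
    congr 1
    ext f
    simp only [List.length_cons, List.length_nil] at hi
    interval_cases i <;> simp [Fin.exists_fin_succ, eq_comm]
  rw [h2]
  have h3 : ([X 0, X 1, X 2] : List (MvPolynomial (Fin 3) F))[i] = X ⟨i, hi⟩ := by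
    simp only [List.length_cons, List.length_nil] at hi
    interval_cases i <;> rfl
  rw [h3]
  exact key _ _ (by simp)

variable {w : (Fin 3 →₀ ℕ) →+ Γ} {e : ℕ} (he : 0 < e) (hw : ∀ i, w (Finsupp.single i e) = 0)
  [Algebra (MvPolynomial (Fin 3) F) (weightZero F w)]
  (halg : ∀ c, (algebraMap (MvPolynomial (Fin 3) F) (weightZero F w) c :
    MvPolynomial (Fin 3) F) = expand e c)

include he hw halg in
lemma isNoetherianRing_weightZero : IsNoetherianRing (weightZero F w) :=
  have := Module.Finite.of_basis (weightZeroBasis he hw halg)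
  IsNoetherianRing.of_finite (MvPolynomial (Fin 3) F) (weightZero F w)

include he hw halg in
lemma mem_map_idealOfVars_iff (f : weightZero F w) :
    f ∈ (idealOfVars (Fin 3) F).map (algebraMap (MvPolynomial (Fin 3) F) (weightZero F w)) ↔
      ∀ m : Fin 3 →₀ ℕ, (∀ i, m i < e) → coeff m (f : MvPolynomial (Fin 3) F) = 0 := by
  constructor
  · intro hf m hm
    have hf' : f ∈ (idealOfVars (Fin 3) F) • (⊤ : Submodule (MvPolynomial (Fin 3) F)
        (weightZero F w)) := by
      rwa [Ideal.smul_top_eq_map]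
    clear hf
    have h : residueLinearMap he halg hm f ∈ idealOfVars (Fin 3) F := by
      induction hf' using Submodule.smul_induction_on' with
      | smul c hc g _ =>
        rw [map_smul]
        exact Ideal.mul_mem_right _ _ hc
      | add x _ y _ hx hy =>
        rw [map_add]
        exact add_mem hx hy
    rw [← pow_one (idealOfVars _ _), mem_pow_idealOfVars_iff'] at h
    have := h 0 (by simp)
    change coeff 0 (residuePart he m (f : MvPolynomial (Fin 3) F)) = 0 at this
    rwa [coeff_residuePart, smul_zero, zero_add] at this
  · intro hf
    rw [← (weightZeroBasis he hw halg).sum_repr f]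
    refine sum_mem fun b _ ↦ ?_
    rw [Algebra.smul_def]
    refine Ideal.mul_mem_right _ _ (Ideal.mem_map_of_mem _ ?_)
    have : (weightZeroBasis he hw halg).repr f b =
      residuePart he b.1 (f : MvPolynomial (Fin 3) F) := rfl
    rw [this, ← pow_one (idealOfVars _ _), mem_pow_idealOfVars_iff]
    intro m hm
    by_contra! h
    have hm0 : m = 0 := by simpa [Finsupp.degree_eq_zero_iff] using h
    rw [hm0, mem_support_iff, coeff_residuePart, smul_zero, zero_add] at hm
    exact hm (hf _ b.2.1)

end WeightZeroSocle

/-- The local statement about socles of Gorenstein rings, with denominators cleared. -/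
lemma exists_mul_sub_mul_mem_of_hasInjectiveDimensionLE {A : Type u} [CommRing A]
    [IsNoetherianRing A] (P : Ideal A) [P.IsPrime] (n : ℕ)
    (hn : HasInjectiveDimensionLE
      (ModuleCat.of (Localization.AtPrime P) (Localization.AtPrime P)) n) (y₁ y₂ y₃ : A)
    (hreg : RingTheory.Sequence.IsWeaklyRegular A [y₁, y₂, y₃]) (r : ℕ)
    (hr : P ^ r ≤ Ideal.ofList [y₁, y₂, y₃]) (s₁ s₂ : A)
    (h₁ : ∀ a ∈ P, a * s₁ ∈ Ideal.ofList [y₁, y₂, y₃])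
    (h₂ : ∀ a ∈ P, a * s₂ ∈ Ideal.ofList [y₁, y₂, y₃])
    (hs₂ : ∀ u ∉ P, u * s₂ ∉ Ideal.ofList [y₁, y₂, y₃]) :
    ∃ u ∉ P, ∃ b, u * s₁ - b * s₂ ∈ Ideal.ofList [y₁, y₂, y₃] := by
  let L := Localization.AtPrime P
  have : IsNoetherianRing L := IsLocalization.isNoetherianRing P.primeCompl L inferInstance
  have : Module.Flat A L := IsLocalization.flat L P.primeCompl
  have hθ : (Ideal.ofList [y₁, y₂, y₃]).map (algebraMap A L) =
      Ideal.span {algebraMap A L y₁, algebraMap A L y₂, algebraMap A L y₃} := by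
    rw [Ideal.map_ofList, Ideal.ofList]
    congr 1
    ext y
    simp
  have hmax : IsLocalRing.maximalIdeal L = P.map (algebraMap A L) := by
    rw [← IsLocalization.map_under P.primeCompl L (IsLocalRing.maximalIdeal L),
      IsLocalization.AtPrime.under_maximalIdeal L P]
  have hsoc (s : A) (hs : ∀ a ∈ P, a * s ∈ Ideal.ofList [y₁, y₂, y₃]) :
      ∀ a ∈ IsLocalRing.maximalIdeal L, a * algebraMap A L s ∈
        Ideal.span {algebraMap A L y₁, algebraMap A L y₂, algebraMap A L y₃} := by
    intro a ha
    rw [hmax] at ha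
    rw [← hθ]
    induction ha using Submodule.span_induction with
    | mem y hy =>
      obtain ⟨f, hf, rfl⟩ := hy
      rw [← map_mul]
      exact Ideal.mem_map_of_mem _ (hs f hf)
    | zero => rw [zero_mul]; exact zero_mem _
    | add y z _ _ hy hz => rw [add_mul]; exact add_mem hy hz
    | smul a y _ hy => rw [smul_eq_mul, mul_assoc]; exact Ideal.mul_mem_left _ _ hy
  have hmem (f : A)
      (hf : algebraMap A L f ∈ (Ideal.ofList [y₁, y₂, y₃]).map (algebraMap A L)) :
      ∃ u ∉ P, u * f ∈ Ideal.ofList [y₁, y₂, y₃] := by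
    obtain ⟨⟨y, u⟩, hy⟩ := (IsLocalization.mem_map_algebraMap_iff P.primeCompl L).mp hf
    rw [← map_mul] at hy
    obtain ⟨c, hc⟩ := (IsLocalization.eq_iff_exists P.primeCompl L).mp hy
    refine ⟨c * u, (c * u).2, ?_⟩
    rw [mul_assoc, mul_comm (u : A), hc]
    exact Ideal.mul_mem_left _ _ y.2
  obtain ⟨a, ha⟩ := exists_sub_mul_mem_of_hasInjectiveDimensionLE (L := L) n
    (algebraMap A L y₁) (algebraMap A L y₂) (algebraMap A L y₃) (hreg.of_flat (S := L)) r
    (by rw [hmax, ← Ideal.map_pow, ← hθ]; exact Ideal.map_mono hr)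
    (algebraMap A L s₁) (algebraMap A L s₂) (hsoc s₁ h₁) (hsoc s₂ h₂) (by
      rw [← hθ]
      intro hc
      obtain ⟨u, hu, hu'⟩ := hmem _ hc
      exact hs₂ u hu hu')
  obtain ⟨⟨b, u⟩, hb⟩ := IsLocalization.surj P.primeCompl a
  rw [← hθ] at ha
  have ha' : algebraMap A L (u * s₁ - b * s₂) ∈
      (Ideal.ofList [y₁, y₂, y₃]).map (algebraMap A L) := by
    have := Ideal.mul_mem_left _ (algebraMap A L u) ha
    convert this using 1
    rw [map_sub, map_mul, map_mul, ← hb]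
    ring
  obtain ⟨v, hv, hv'⟩ := hmem _ ha'
  refine ⟨v * u, P.primeCompl.mul_mem hv u.2, v * b, ?_⟩
  rwa [mul_assoc, mul_assoc, ← mul_sub]

section WeightZeroMaximal
variable {F : Type u} [Field F] {Γ : Type*} [AddCommGroup Γ]

/-- The ideal of polynomials of weight zero with vanishing constant term. -/
def weightZeroIdeal (F : Type u) [Field F] (w : (Fin 3 →₀ ℕ) →+ Γ) : Ideal (weightZero F w) :=
  RingHom.ker ((constantCoeff (R := F) (σ := Fin 3)).comp (weightZero F w).val.toRingHom)

instance (w : (Fin 3 →₀ ℕ) →+ Γ) : (weightZeroIdeal F w).IsPrime :=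
  RingHom.ker_isPrime _

lemma mem_weightZeroIdeal {w : (Fin 3 →₀ ℕ) →+ Γ} {f : weightZero F w} :
    f ∈ weightZeroIdeal F w ↔ coeff 0 (f : MvPolynomial (Fin 3) F) = 0 := Iff.rfl

variable {w : (Fin 3 →₀ ℕ) →+ Γ} {e : ℕ} (he : 0 < e) (hw : ∀ i, w (Finsupp.single i e) = 0)
  [Algebra (MvPolynomial (Fin 3) F) (weightZero F w)]
  (halg : ∀ c, (algebraMap (MvPolynomial (Fin 3) F) (weightZero F w) c :
    MvPolynomial (Fin 3) F) = expand e c)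

include he hw halg in
lemma weightZeroIdeal_pow_le : weightZeroIdeal F w ^ (3 * e) ≤
    (idealOfVars (Fin 3) F).map (algebraMap (MvPolynomial (Fin 3) F) (weightZero F w)) := by
  intro f hf
  rw [mem_map_idealOfVars_iff he hw halg]
  intro m hm
  have h1 : (weightZeroIdeal F w).map (weightZero F w).val.toRingHom ≤ idealOfVars (Fin 3) F := by
    rw [Ideal.map_le_iff_le_comap]
    intro g hg
    rw [Ideal.mem_comap, ← pow_one (idealOfVars _ _), mem_pow_idealOfVars_iff']
    intro x hx
    rw [show x = 0 by simpa [Finsupp.degree_eq_zero_iff] using hx]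
    exact mem_weightZeroIdeal.mp hg
  have h2 := Ideal.pow_right_mono h1 (3 * e)
  rw [← Ideal.map_pow] at h2
  have h3 := h2 (Ideal.mem_map_of_mem _ hf)
  rw [mem_pow_idealOfVars_iff'] at h3
  refine h3 m ?_
  rw [Finsupp.degree_eq_sum, Fin.sum_univ_three]
  have := hm 0
  have := hm 1
  have := hm 2
  lia

/-- The monomial with exponent `m`, as a polynomial of weight zero. -/
def weightZeroMonomial (F : Type u) [Field F] {w : (Fin 3 →₀ ℕ) →+ Γ} {m : Fin 3 →₀ ℕ}
    (hm : w m = 0) : weightZero F w :=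
  ⟨monomial m 1, monomial_mem_weightZero hm 1⟩

lemma coeff_mul_weightZeroMonomial {w : (Fin 3 →₀ ℕ) →+ Γ} {m : Fin 3 →₀ ℕ} (hm : w m = 0)
    (f : weightZero F w) (k : Fin 3 →₀ ℕ) :
    coeff k ((f * weightZeroMonomial F hm : weightZero F w) : MvPolynomial (Fin 3) F) =
      if m ≤ k then coeff (k - m) (f : MvPolynomial (Fin 3) F) else 0 := by
  have h : ((f * weightZeroMonomial F hm : weightZero F w) : MvPolynomial (Fin 3) F) =
    (f : MvPolynomial (Fin 3) F) * monomial m 1 := rfl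
  rw [h, coeff_mul_monomial', mul_one]

include he hw halg in
lemma mul_monomial_mem_map_idealOfVars {N : Fin 3 →₀ ℕ} (hN : Maximal (· ∈ weightBox w e) N)
    {f : weightZero F w} (hf : f ∈ weightZeroIdeal F w) :
    f * weightZeroMonomial F hN.1.2 ∈
      (idealOfVars (Fin 3) F).map (algebraMap (MvPolynomial (Fin 3) F) (weightZero F w)) := by
  rw [mem_map_idealOfVars_iff he hw halg]
  intro m hm
  by_contra h
  have hm0 := (f * weightZeroMonomial F hN.1.2 : weightZero F w).2 m h
  rw [coeff_mul_weightZeroMonomial] at h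
  obtain ⟨hle, h⟩ := ite_ne_right_iff.mp h
  have hmN := le_antisymm (hN.2 ⟨hm, hm0⟩ hle) hle
  rw [hmN, tsub_self] at h
  exact h (mem_weightZeroIdeal.mp hf)

include he hw halg in
lemma maximal_weightBox_unique (h : ∀ (P : Ideal (weightZero F w)) [P.IsPrime],
      ∃ n, HasInjectiveDimensionLE (ModuleCat.of (Localization.AtPrime P)
        (Localization.AtPrime P)) n)
    {N₁ N₂ : Fin 3 →₀ ℕ} (hN₁ : Maximal (· ∈ weightBox w e) N₁)
    (hN₂ : Maximal (· ∈ weightBox w e) N₂) : N₁ = N₂ := by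
  have := isNoetherianRing_weightZero he hw halg
  have := Module.Projective.of_basis (weightZeroBasis he hw halg)
  let x (i : Fin 3) : weightZero F w :=
    algebraMap (MvPolynomial (Fin 3) F) (weightZero F w) (X i : MvPolynomial (Fin 3) F)
  have hreg : RingTheory.Sequence.IsWeaklyRegular (weightZero F w) [x 0, x 1, x 2] :=
    (isWeaklyRegular_X (F := F)).of_flat (S := weightZero F w)
  have hspan : (idealOfVars (Fin 3) F).map
      (algebraMap (MvPolynomial (Fin 3) F) (weightZero F w)) =
      Ideal.ofList [x 0, x 1, x 2] := by
    rw [idealOfVars, Ideal.map_span, Ideal.ofList, ← Set.range_comp]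
    congr 1
    ext y
    simp [x, Fin.exists_fin_succ, eq_comm]
  have hiff (f : weightZero F w) : f ∈ Ideal.ofList [x 0, x 1, x 2] ↔
      ∀ m : Fin 3 →₀ ℕ, (∀ i, m i < e) → coeff m (f : MvPolynomial (Fin 3) F) = 0 := by
    rw [← hspan, mem_map_idealOfVars_iff he hw halg]
  obtain ⟨n, hn⟩ := h (weightZeroIdeal F w)
  have hr : weightZeroIdeal F w ^ (3 * e) ≤ Ideal.ofList [x 0, x 1, x 2] := by
    rw [← hspan]
    exact weightZeroIdeal_pow_le he hw halg
  have hsoc {N : Fin 3 →₀ ℕ} (hN : Maximal (· ∈ weightBox w e) N) :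
      ∀ f ∈ weightZeroIdeal F w,
        f * weightZeroMonomial F hN.1.2 ∈ Ideal.ofList [x 0, x 1, x 2] := by
    intro f hf
    rw [← hspan]
    exact mul_monomial_mem_map_idealOfVars he hw halg hN hf
  have hs₂ : ∀ u ∉ weightZeroIdeal F w,
      u * weightZeroMonomial F hN₂.1.2 ∉ Ideal.ofList [x 0, x 1, x 2] := by
    intro u hu h
    rw [hiff] at h
    have := h N₂ hN₂.1.1
    rw [coeff_mul_weightZeroMonomial, if_pos le_rfl, tsub_self] at this
    exact hu (mem_weightZeroIdeal.mpr this)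
  obtain ⟨u, hu, b, hb⟩ := exists_mul_sub_mul_mem_of_hasInjectiveDimensionLE
    (weightZeroIdeal F w) n hn (x 0) (x 1) (x 2) hreg (3 * e) hr
    (weightZeroMonomial F hN₁.1.2) (weightZeroMonomial F hN₂.1.2) (hsoc hN₁) (hsoc hN₂) hs₂
  rw [hiff] at hb
  have h1 := hb N₁ hN₁.1.1
  rw [AddSubgroupClass.coe_sub, coeff_sub, coeff_mul_weightZeroMonomial,
    coeff_mul_weightZeroMonomial, if_pos le_rfl, tsub_self] at h1
  by_contra hne
  rw [if_neg fun hle ↦ hne (le_antisymm (hN₂.2 hN₁.1 hle) hle), sub_zero] at h1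
  exact hu (mem_weightZeroIdeal.mpr h1)

include he hw halg in
lemma weight_eq_zero_of_hasInjectiveDimensionLE (h : ∀ (P : Ideal (weightZero F w)) [P.IsPrime],
      ∃ n, HasInjectiveDimensionLE (ModuleCat.of (Localization.AtPrime P)
        (Localization.AtPrime P)) n)
    (hbox : ∀ i, ∃ b ∈ weightBox w e, b i + 1 = e) {N : Fin 3 →₀ ℕ} (hN : ∀ i, N i + 1 = e) :
    w N = 0 := by
  choose b hb hbe using hbox
  choose M hM hMmax using fun i ↦ (finite_weightBox w e).exists_le_maximal (hb i)
  have key : M 0 = N := by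
    ext i
    rw [maximal_weightBox_unique he hw halg h (hMmax 0) (hMmax i)]
    have h1 := hM i i
    have h2 := hbe i
    have h3 := (hMmax i).1.1 i
    have h4 := hN i
    lia
  rw [← key]
  exact (hMmax 0).1.2

end WeightZeroMaximal

lemma isGorensteinRing_iff (R : Type u) [CommRing R] : IsGorensteinRing R ↔
    IsNoetherianRing R ∧ ∀ (P : Ideal R) [P.IsPrime], ∃ n, HasInjectiveDimensionLE
      (ModuleCat.of (Localization.AtPrime P) (Localization.AtPrime P)) n := by
  simp only [IsGorensteinRing, hasFiniteInjectiveDimension_iff]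

lemma hasInjectiveDimensionLE_of_ringEquiv {R S : Type u} [CommRing R] [CommRing S]
    (e : R ≃+* S) (n : ℕ) (h : HasInjectiveDimensionLE (ModuleCat.of R R) n) :
    HasInjectiveDimensionLE (ModuleCat.of S S) n := by
  let _ : RingHomInvPair (e : R →+* S) (e.symm : S →+* R) := RingHomInvPair.of_ringEquiv e
  let _ : RingHomInvPair (e.symm : S →+* R) (e : R →+* S) := RingHomInvPair.of_ringEquiv e.symm
  let e' : ModuleCat.of R R ≃ₛₗ[RingHomClass.toRingHom e] ModuleCat.of S S :=
    { e.toAddEquiv with map_smul' := fun x y ↦ map_mul e x y }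
  exact (ModuleCat.hasInjectiveDimensionLE_iff_of_semiLinearEquiv e e' n).mp h

lemma IsGorensteinRing.of_ringEquiv {R S : Type u} [CommRing R] [CommRing S] (e : R ≃+* S)
    (h : IsGorensteinRing R) : IsGorensteinRing S := by
  rw [isGorensteinRing_iff] at h ⊢
  refine ⟨have := h.1; isNoetherianRing_of_ringEquiv R e, fun Q _ ↦ ?_⟩
  obtain ⟨n, hn⟩ := h.2 (Q.comap e)
  refine ⟨n, hasInjectiveDimensionLE_of_ringEquiv
    (IsLocalization.ringEquivOfRingEquiv (M := (Q.comap e).primeCompl) (T := Q.primeCompl)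
      _ _ e ?_) n hn⟩
  ext x
  constructor
  · rintro ⟨y, hy, rfl⟩
    exact hy
  · intro hx
    exact ⟨e.symm x, fun h ↦ hx (by simpa using h), e.apply_symm_apply x⟩

section Criterion
variable {F : Type u} [Field F] {Γ : Type*} [AddCommGroup Γ]

/-- The weight on exponents under which the `i`-th variable has weight `γ i`. -/
def weightHom (γ : Fin 3 → Γ) : (Fin 3 →₀ ℕ) →+ Γ :=
  (Finsupp.linearCombination ℕ γ).toAddMonoidHom

lemma weightHom_apply (γ : Fin 3 → Γ) (m : Fin 3 →₀ ℕ) :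
    weightHom γ m = m 0 • γ 0 + m 1 • γ 1 + m 2 • γ 2 := by
  change Finsupp.linearCombination ℕ γ m = _
  rw [Finsupp.linearCombination_apply, Finsupp.sum_fintype _ _ (by simp), Fin.sum_univ_three]

lemma isGorensteinRing_weightZero_iff (γ : Fin 3 → Γ) {e : ℕ} (he : 0 < e)
    (hγ : ∀ i, e • γ i = 0)
    (hdep : ∀ i, ∃ b : Fin 3 → ℤ, b i = -1 ∧ b 0 • γ 0 + b 1 • γ 1 + b 2 • γ 2 = 0) :
    IsGorensteinRing (weightZero F (weightHom γ)) ↔ γ 0 + γ 1 + γ 2 = 0 := by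
  have hw (i) : weightHom γ (Finsupp.single i e) = 0 := by
    change Finsupp.linearCombination ℕ γ _ = _
    rw [Finsupp.linearCombination_single, hγ]
  let _ : Algebra (MvPolynomial (Fin 3) F) (weightZero F (weightHom γ)) :=
    (expandWeightZero hw).toRingHom.toAlgebra
  have halg (c) : (algebraMap (MvPolynomial (Fin 3) F) (weightZero F (weightHom γ)) c :
    MvPolynomial (Fin 3) F) = expand e c := rfl
  have := isNoetherianRing_weightZero he hw halg
  let N : Fin 3 →₀ ℕ := Finsupp.equivFunOnFinite.symm fun _ ↦ e - 1
  have hN (i) : N i + 1 = e := Nat.sub_add_cancel he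
  have hwN : weightHom γ N = 0 ↔ γ 0 + γ 1 + γ 2 = 0 := by
    have h1 : weightHom γ N + (γ 0 + γ 1 + γ 2) = 0 := by
      have h2 : weightHom γ N + (γ 0 + γ 1 + γ 2) =
          (N 0 + 1) • γ 0 + (N 1 + 1) • γ 1 + (N 2 + 1) • γ 2 := by
        rw [weightHom_apply]
        simp only [succ_nsmul]
        abel
      rw [h2]
      simp [hN, hγ]
    constructor <;> intro h <;> simpa [h] using h1
  have hbox (i) : ∃ b ∈ weightBox (weightHom γ) e, b i + 1 = e := by
    obtain ⟨b, hb, hb0⟩ := hdep i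
    have he' : (0 : ℤ) < e := by exact_mod_cast he
    have hbe (j) : ((b j % e).toNat : ℤ) = b j % e :=
      Int.toNat_of_nonneg (Int.emod_nonneg _ he'.ne')
    have hbγ (j) : (b j % e).toNat • γ j = b j • γ j := by
      rw [← natCast_zsmul, hbe, Int.emod_def, sub_smul, mul_comm, mul_smul, natCast_zsmul, hγ,
        smul_zero, sub_zero]
    refine ⟨Finsupp.equivFunOnFinite.symm fun j ↦ (b j % e).toNat, ⟨fun j ↦ ?_, ?_⟩, ?_⟩
    · have := Int.emod_lt_of_pos (b j) he'
      have := hbe j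
      simp only [Finsupp.equivFunOnFinite_symm_apply_apply]
      lia
    · rw [weightHom_apply]
      simp only [Finsupp.equivFunOnFinite_symm_apply_apply, hbγ, hb0]
    · have h1 := hbe i
      simp only [Finsupp.equivFunOnFinite_symm_apply_apply]
      rw [hb] at h1 ⊢
      have h2 : (-1 : ℤ) % e = e - 1 := by
        rw [← Int.add_emod_right, Int.emod_eq_of_lt] <;> lia
      lia
  rw [← hwN, isGorensteinRing_iff]
  refine ⟨fun h ↦ weight_eq_zero_of_hasInjectiveDimensionLE he hw halg h.2 hbox hN, fun h ↦
    ⟨this, fun P _ ↦ ⟨3, hasInjectiveDimensionLE_localization P.primeCompl 3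
      (hasInjectiveDimensionLE_weightZero he hw halg N hN h)⟩⟩⟩

lemma isGorensteinRing_weightZero_iff_of_coprime (γ : Fin 3 → Γ) (h0 : γ 0 + γ 1 + γ 2 = 0)
    {e : ℕ} (he : 0 < e) (hγ : ∀ i, e • γ i = 0) {q₁ q₂ : ℕ} (h₁ : q₁.Coprime e)
    (h₂ : q₂.Coprime e) :
    IsGorensteinRing (weightZero F (weightHom ![q₁ • γ 0, q₂ • γ 1, γ 2])) ↔
      q₁ • γ 0 + q₂ • γ 1 + γ 2 = 0 := by
  have hinv {q : ℕ} (hq : q.Coprime e) : ∃ k : ℤ, ∀ i, k • q • γ i = γ i := by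
    refine ⟨q.gcdA e, fun i ↦ ?_⟩
    have h := congrArg (· • γ i) (Nat.gcd_eq_gcd_ab q e)
    simp only [hq.gcd_eq_one, Nat.cast_one, one_smul, add_smul] at h
    rw [mul_comm, mul_smul, mul_comm, mul_smul, natCast_zsmul, natCast_zsmul, hγ, smul_zero,
      add_zero] at h
    exact h.symm
  obtain ⟨k₁, hk₁⟩ := hinv h₁
  obtain ⟨k₂, hk₂⟩ := hinv h₂
  refine isGorensteinRing_weightZero_iff _ he (fun i ↦ ?_) fun i ↦ ?_
  · fin_cases i
    · simp [smul_comm e, hγ]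
    · simp [smul_comm e, hγ]
    · exact hγ 2
  have hγ2 : γ 2 = -γ 0 - γ 1 := by
    rw [eq_sub_iff_add_eq, eq_neg_iff_add_eq_zero, ← h0]
    abel
  fin_cases i
  · refine ⟨![-1, -(q₁ * k₂), -q₁], rfl, ?_⟩
    simp only [Matrix.cons_val, neg_smul, mul_smul, hk₂, hγ2, natCast_zsmul, smul_sub, smul_neg,
      one_smul]
    abel
  · refine ⟨![-(q₂ * k₁), -1, -q₂], rfl, ?_⟩
    simp only [Matrix.cons_val, neg_smul, mul_smul, hk₁, hγ2, natCast_zsmul, smul_sub, smul_neg,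
      one_smul]
    abel
  · refine ⟨![-k₁, -k₂, -1], rfl, ?_⟩
    simp only [Matrix.cons_val, neg_smul, hk₁, hk₂, hγ2, one_smul]
    abel

end Criterion

namespace Polynomial

lemma comp_left_injective {D : Type*} [CommRing D] [IsDomain D] {f : D[X]}
    (hf : f.natDegree ≠ 0) : Function.Injective fun g : D[X] ↦ g.comp f := by
  intro g h hgh
  rw [← sub_eq_zero] at hgh ⊢
  change g.comp f - h.comp f = 0 at hgh
  rw [← sub_comp, comp_eq_zero_iff] at hgh
  exact hgh.resolve_right fun h ↦ hf (by rw [h.2, natDegree_C])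

/-- A polynomial invariant under the translations by as many elements as the degree of the monic
invariant polynomial `f` is a polynomial in `f`. -/
lemma exists_comp_eq_of_comp_X_add_C {D : Type*} [CommRing D] [IsDomain D] {f : D[X]}
    (hf : f.Monic) (hf0 : f.natDegree ≠ 0) (s : Finset D) (hs : s.card = f.natDegree)
    (hfs : ∀ t ∈ s, f.comp (X + C t) = f) (g : D[X]) (hg : ∀ t ∈ s, g.comp (X + C t) = g) :
    ∃ h : D[X], g = h.comp f := by
  induction hn : g.natDegree using Nat.strong_induction_on generalizing g with
  | _ n ih =>
  have hlt : (g %ₘ f).natDegree < f.natDegree :=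
    natDegree_modByMonic_lt g hf fun h ↦ hf0 (by rw [h, natDegree_one])
  have hdiv (t) (ht : t ∈ s) : (g /ₘ f).comp (X + C t) = g /ₘ f ∧
      (g %ₘ f).comp (X + C t) = g %ₘ f := by
    have := div_modByMonic_unique (f := g) ((g /ₘ f).comp (X + C t)) ((g %ₘ f).comp (X + C t)) hf
      ⟨by
        nth_rw 2 [← hfs t ht]
        rw [← mul_comp, ← add_comp, modByMonic_add_div, hg t ht], by
        refine degree_lt_degree ?_
        rwa [natDegree_comp, natDegree_X_add_C, mul_one]⟩
    exact ⟨this.1.symm, this.2.symm⟩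
  have hconst : g %ₘ f = C ((g %ₘ f).eval 0) := by
    rw [← sub_eq_zero]
    refine eq_zero_of_natDegree_lt_card_of_eval_eq_zero' _ s (fun t ht ↦ ?_) ?_
    · rw [eval_sub, eval_C, sub_eq_zero]
      nth_rw 2 [← (hdiv t ht).2]
      rw [eval_comp, eval_add, eval_X, eval_C, zero_add]
    · rwa [natDegree_sub_C, hs]
  by_cases hg0 : g.natDegree = 0
  · refine ⟨C (g.coeff 0), ?_⟩
    rw [C_comp]
    exact eq_C_of_natDegree_eq_zero hg0
  obtain ⟨h, hh⟩ := ih (g /ₘ f).natDegree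
    (by rw [natDegree_divByMonic _ hf]; lia) (g /ₘ f) (fun t ht ↦ (hdiv t ht).1) rfl
  refine ⟨X * h + C ((g %ₘ f).eval 0), ?_⟩
  rw [add_comp, mul_comp, X_comp, C_comp, ← hh, ← hconst, add_comm, modByMonic_add_div]

section Twist
variable {F R : Type*} [CommRing F] [CommRing R] [Algebra F R]

/-- The endomorphism of `R[X]` given by `φ` on `R` and by `X ↦ l X + r`. -/
def twist (φ : R →ₐ[F] R) (l r : R) : R[X] →ₐ[F] R[X] :=
  eval₂AlgHom (CAlgHom.comp φ) (C l * X + C r) fun _ ↦ Commute.all _ _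

@[simp]
lemma twist_C (φ : R →ₐ[F] R) (l r x : R) : twist φ l r (C x) = C (φ x) :=
  eval₂_C _ _

@[simp]
lemma twist_X (φ : R →ₐ[F] R) (l r : R) : twist φ l r X = C l * X + C r :=
  eval₂_X _ _

lemma twist_eq_comp (φ : R →ₐ[F] R) (l r : R) (f : R[X]) :
    twist φ l r f = (f.map (φ : R →+* R)).comp (C l * X + C r) := by
  rw [comp, eval₂_map]
  rfl

lemma coeff_twist [IsDomain R] (φ : R →ₐ[F] R) {l : R} (hl : l ≠ 0) (r : R) {f : R[X]}
    (hf : f.Monic) {k : ℕ} (hk : f.natDegree ≤ k) :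
    (twist φ l r f).coeff k = l ^ f.natDegree * f.coeff k := by
  have hf' := hf.map (φ : R →+* R)
  have hdeg := hf.natDegree_map (φ : R →+* R)
  have h1 := natDegree_linear (b := r) hl
  rw [twist_eq_comp]
  obtain rfl | hlt := hk.eq_or_lt
  · have := coeff_comp_degree_mul_degree (p := f.map (φ : R →+* R)) (q := C l * X + C r)
      (by rw [h1]; exact one_ne_zero)
    rw [h1, mul_one, hdeg, hf'.leadingCoeff, leadingCoeff_linear hl, one_mul] at this
    rw [this, coeff_natDegree, hf.leadingCoeff, mul_one]
  · rw [coeff_eq_zero_of_natDegree_lt hlt, mul_zero]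
    refine coeff_eq_zero_of_natDegree_lt (natDegree_comp_le.trans_lt ?_)
    rwa [h1, mul_one, hdeg]

end Twist

end Polynomial

/-- Averaging an element fixed by a normal subgroup produces a semi-invariant for the character
`ψ`. -/
lemma exists_semiinvariant {F H R R' : Type*} [Field F] [Group H] [Finite H] [AddCommGroup R]
    [Module F R] [AddCommGroup R'] [Module F R'] (act : H → R →ₗ[F] R)
    (hact : ∀ g h x, act (g * h) x = act h (act g x)) (ψ : H →* Fˣ) (T : Subgroup H) [T.Normal]
    (hcard : (Nat.card (H ⧸ T) : F) ≠ 0) (hψ : ∀ t ∈ T, ψ t = 1) (x : R)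
    (hx : ∀ t ∈ T, act t x = x) :
    ∃ y : R, (∀ g, act g y = ψ g • y) ∧
      ∀ ℓ : R →ₗ[F] R', (∀ h, ℓ (act h x) = ψ h • ℓ x) → ℓ y = ℓ x := by
  classical
  have := Fintype.ofFinite (H ⧸ T)
  have hout (g h : H) (hgh : (g : H ⧸ T) = h) : (ψ g)⁻¹ • act g x = (ψ h)⁻¹ • act h x := by
    obtain ⟨t, ht, rfl⟩ : ∃ t ∈ T, h = t * g := by
      refine ⟨h * g⁻¹, ?_, by group⟩
      have := Subgroup.Normal.mem_comm ‹_› (QuotientGroup.eq.mp hgh)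
      simpa using this
    rw [map_mul, hψ t ht, one_mul, hact, hx t ht]
  refine ⟨(Nat.card (H ⧸ T) : F)⁻¹ • ∑ q : H ⧸ T, (ψ q.out)⁻¹ • act q.out x, fun g ↦ ?_,
    fun ℓ hℓ ↦ ?_⟩
  · rw [map_smul, smul_comm (ψ g), map_sum]
    congr 1
    rw [Finset.smul_sum]
    refine Fintype.sum_equiv (Equiv.mulRight (g : H ⧸ T)) _ _ fun q ↦ ?_
    have h1 := hout (q.out * g) (q * g : H ⧸ T).out (by simp)
    rw [Equiv.coe_mulRight, ← h1, hact, map_mul, mul_inv, smul_smul, mul_comm (ψ q.out)⁻¹,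
      mul_inv_cancel_left]
    exact map_smul (act g) _ _
  · rw [map_smul, map_sum]
    have (q : H ⧸ T) : ℓ ((ψ q.out)⁻¹ • act q.out x) = ℓ x := by
      rw [Units.smul_def, map_smul, hℓ, ← Units.smul_def, inv_smul_smul]
    simp only [this, Finset.sum_const, Finset.card_univ, ← Nat.card_eq_fintype_card]
    rw [← Nat.cast_smul_eq_nsmul F, smul_smul, inv_mul_cancel₀ hcard, one_smul]

namespace Polynomial

section TwistInvariant
variable {F R H : Type*} [Field F] [CommRing R] [Group H] [Finite H]

/-- The product of the linear factors `X + τ m` for `m ∈ M`. -/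
def translateProd (M : AddSubgroup F) [Finite M] (τ : F →+ R) : R[X] :=
  letI := Fintype.ofFinite M
  ∏ m : M, (X + C (τ m))

lemma monic_translateProd (M : AddSubgroup F) [Finite M] (τ : F →+ R) :
    (translateProd M τ).Monic :=
  monic_prod_of_monic _ _ fun _ _ ↦ monic_X_add_C _

lemma natDegree_translateProd [Nontrivial R] (M : AddSubgroup F) [Finite M] (τ : F →+ R) :
    (translateProd M τ).natDegree = Nat.card M := by
  let _ := Fintype.ofFinite M
  rw [translateProd, natDegree_prod_of_monic _ _ fun _ _ ↦ monic_X_add_C _]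
  simp [Nat.card_eq_fintype_card]

lemma twist_translateProd [Algebra F R] (M : AddSubgroup F) [Finite M] (τ : F →+ R) (φ : R →ₐ[F] R)
    (hφ : ∀ m, φ (τ m) = τ m) {m : F} (hm : m ∈ M) :
    twist φ 1 (τ m) (translateProd M τ) = translateProd M τ := by
  let _ := Fintype.ofFinite M
  rw [translateProd, map_prod]
  refine Fintype.prod_equiv (Equiv.addLeft (⟨m, hm⟩ : M)) _ _ fun x ↦ ?_
  simp [hφ, add_assoc]

/-- A monic semi-invariant of degree the order of the group of translations. -/
lemma exists_monic_semiinvariant [IsDomain R] [Algebra F R] (φ : H → R →ₐ[F] R) (χ : H →* Fˣ) (r : H → R)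
    (hact : ∀ g h x, twist (φ (g * h)) (algebraMap F R (χ (g * h))) (r (g * h)) x =
      twist (φ h) (algebraMap F R (χ h)) (r h) (twist (φ g) (algebraMap F R (χ g)) (r g) x))
    (T : Subgroup H) [T.Normal] (hcard : (Nat.card (H ⧸ T) : F) ≠ 0)
    (M : AddSubgroup F) [Finite M] (τ : F →+ R)
    (hT : ∀ t ∈ T, χ t = 1 ∧ (∀ m, φ t (τ m) = τ m) ∧ ∃ m ∈ M, r t = τ m) :
    ∃ f : R[X], f.Monic ∧ f.natDegree = Nat.card M ∧
      ∀ h, twist (φ h) (algebraMap F R (χ h)) (r h) f = χ h ^ Nat.card M • f := by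
  have hl (h : H) : algebraMap F R (χ h) ≠ 0 :=
    (_root_.map_ne_zero (algebraMap F R)).mpr (χ h).ne_zero
  obtain ⟨f, hf, hℓ⟩ := exists_semiinvariant (R' := R)
    (fun h ↦ (twist (φ h) (algebraMap F R (χ h)) (r h)).toLinearMap) hact (χ ^ Nat.card M) T hcard
    (fun t ht ↦ by simp [(hT t ht).1]) (translateProd M τ) (fun t ht ↦ by
      obtain ⟨h1, h2, m, hm, h3⟩ := hT t ht
      simpa [h1, h3] using twist_translateProd M τ (φ t) h2 hm)
  have hcoeff (k : ℕ) (hk : Nat.card M ≤ k) : f.coeff k = (translateProd M τ).coeff k := by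
    refine hℓ ((lcoeff R k).restrictScalars F) fun h ↦ ?_
    have := coeff_twist (φ h) (hl h) (r h) (monic_translateProd M τ) (k := k)
      (by rwa [natDegree_translateProd])
    rw [natDegree_translateProd] at this
    simp only [LinearMap.coe_restrictScalars, lcoeff_apply, AlgHom.toLinearMap_apply, this]
    rw [MonoidHom.pow_apply, Units.smul_def, Algebra.smul_def, Units.val_pow_eq_pow_val, map_pow]
  have hdeg : f.natDegree ≤ Nat.card M := by
    rw [natDegree_le_iff_coeff_eq_zero]
    intro k hk
    rw [hcoeff k hk.le, coeff_eq_zero_of_natDegree_lt (by rwa [natDegree_translateProd])]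
  have hone : f.coeff (Nat.card M) = 1 := by
    rw [hcoeff _ le_rfl, ← natDegree_translateProd M τ]
    exact monic_translateProd M τ
  refine ⟨f, monic_of_natDegree_le_of_coeff_eq_one _ hdeg hone,
    natDegree_eq_of_le_of_coeff_ne_zero hdeg (by simp [hone]), fun h ↦ hf h⟩

end TwistInvariant

end Polynomial

section BlockAction
variable {F : Type u} [Field F]

open Polynomial in
/-- The action of a matrix on the third variable. -/
def actThird (A : Matrix (Fin 3) (Fin 3) F) : F[X] →ₐ[F] F[X] :=
  Polynomial.aeval (Polynomial.C (A 2 2) * Polynomial.X)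

open Polynomial in
/-- The action of a matrix on the first and the third variable. -/
def actFirst (A : Matrix (Fin 3) (Fin 3) F) : F[X][X] →ₐ[F] F[X][X] :=
  Polynomial.twist (actThird A) (algebraMap F _ (A 0 0)) (Polynomial.C (A 0 2) * Polynomial.X)

open Polynomial in
/-- The action of a matrix on three variables, as iterated polynomials. -/
def actAll (A : Matrix (Fin 3) (Fin 3) F) : F[X][X][X] →ₐ[F] F[X][X][X] :=
  Polynomial.twist (actFirst A) (algebraMap F _ (A 1 1))
    (Polynomial.C (Polynomial.C (A 1 0)) * Polynomial.X +
      Polynomial.C (Polynomial.C (A 1 2) * Polynomial.X))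

open Polynomial in
/-- Polynomials in three variables as iterated polynomials, adjoining first the third, then the
first and finally the second variable. -/
def iteratedEquiv (F : Type u) [Field F] : MvPolynomial (Fin 3) F ≃ₐ[F] F[X][X][X] :=
  AlgEquiv.ofAlgHom
    (MvPolynomial.aeval ![(Polynomial.C Polynomial.X : F[X][X][X]), Polynomial.X,
      Polynomial.C (Polynomial.C Polynomial.X)])
    (Polynomial.eval₂AlgHom (Polynomial.eval₂AlgHom (Polynomial.aeval (MvPolynomial.X 2))
      (MvPolynomial.X 0) fun _ ↦ Commute.all _ _) (MvPolynomial.X 1) fun _ ↦ Commute.all _ _)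
    (by
      refine Polynomial.algHom_ext' (Polynomial.algHom_ext' (Polynomial.algHom_ext ?_) ?_) ?_ <;>
      simp)
    (by
      refine MvPolynomial.algHom_ext fun i ↦ ?_
      fin_cases i <;> simp)

@[simp]
lemma iteratedEquiv_X (i : Fin 3) : iteratedEquiv F (MvPolynomial.X i) =
    ![Polynomial.C Polynomial.X, Polynomial.X, Polynomial.C (Polynomial.C Polynomial.X)] i :=
  MvPolynomial.aeval_X _ _

@[simp]
lemma iteratedEquiv_C (r : F) : iteratedEquiv F (MvPolynomial.C r) =
    Polynomial.C (Polynomial.C (Polynomial.C r)) :=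
  (iteratedEquiv F).commutes r

lemma polyAct_mul (A B : Matrix (Fin 3) (Fin 3) F) (f : MvPolynomial (Fin 3) F) :
    polyAct (A * B) f = polyAct B (polyAct A f) := by
  rw [← AlgHom.comp_apply]
  congr 1
  refine MvPolynomial.algHom_ext fun i ↦ ?_
  simp only [polyAct, aeval_X, AlgHom.comp_apply, map_sum, map_smul, Matrix.mul_apply,
    Finset.sum_smul, Finset.smul_sum, smul_smul]
  exact Finset.sum_comm

lemma iteratedEquiv_polyAct {A : Matrix (Fin 3) (Fin 3) F} (h01 : A 0 1 = 0) (h20 : A 2 0 = 0)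
    (h21 : A 2 1 = 0) (f : MvPolynomial (Fin 3) F) :
    iteratedEquiv F (polyAct A f) = actAll A (iteratedEquiv F f) := by
  have : (iteratedEquiv F).toAlgHom.comp (polyAct A) =
      (actAll A).comp (iteratedEquiv F).toAlgHom := by
    refine MvPolynomial.algHom_ext fun i ↦ ?_
    fin_cases i
    on_goal 2 => simp [polyAct, Fin.sum_univ_three, actAll, Algebra.smul_def,
      Polynomial.algebraMap_apply]; ring
    all_goals simp [polyAct, Fin.sum_univ_three, h01, h20, h21, actAll, actFirst, actThird,
      Algebra.smul_def, Polynomial.algebraMap_apply]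
  exact DFunLike.congr_fun this f

end BlockAction

section BlockInvariants
variable {F : Type u} [Field F] {H : Type*} [Group H] [Finite H]

open Polynomial in
lemma actAll_mul {A B : Matrix (Fin 3) (Fin 3) F} (hA : A 0 1 = 0 ∧ A 2 0 = 0 ∧ A 2 1 = 0)
    (hB : B 0 1 = 0 ∧ B 2 0 = 0 ∧ B 2 1 = 0) (f : F[X][X][X]) :
    actAll (A * B) f = actAll B (actAll A f) := by
  obtain ⟨f, rfl⟩ := (iteratedEquiv F).surjective f
  rw [← iteratedEquiv_polyAct hA.1 hA.2.1 hA.2.2, ← iteratedEquiv_polyAct hB.1 hB.2.1 hB.2.2,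
    ← polyAct_mul]
  refine (iteratedEquiv_polyAct ?_ ?_ ?_ f).symm <;>
  simp [Matrix.mul_apply, Fin.sum_univ_three, hA, hB]

open Polynomial in
lemma actFirst_mul {A B : Matrix (Fin 3) (Fin 3) F} (hA : A 0 1 = 0 ∧ A 2 0 = 0 ∧ A 2 1 = 0)
    (hB : B 0 1 = 0 ∧ B 2 0 = 0 ∧ B 2 1 = 0) (f : F[X][X]) :
    actFirst (A * B) f = actFirst B (actFirst A f) := by
  refine Polynomial.C_injective ?_
  have := actAll_mul hA hB (Polynomial.C f)
  simpa only [actAll, Polynomial.twist_C] using this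

open Polynomial in
/-- The embedding of `F` into the multiples of the third variable. -/
def scaleThird (F : Type u) [Field F] : F →+ F[X] :=
  (AddMonoidHom.mulRight (Polynomial.X : F[X])).comp (Polynomial.C : F →+* F[X]).toAddMonoidHom

lemma scaleThird_apply (m : F) :
    scaleThird F m = Polynomial.C m * (Polynomial.X : Polynomial F) := rfl

lemma actThird_scaleThird {A : Matrix (Fin 3) (Fin 3) F} (hA : A 2 2 = 1) (m : F) :
    actThird A (scaleThird F m) = scaleThird F m := by
  simp [actThird, scaleThird_apply, hA]

open Polynomial in
lemma actFirst_eq_comp {A : Matrix (Fin 3) (Fin 3) F} (h0 : A 0 0 = 1) (h2 : A 2 2 = 1)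
    (f : F[X][X]) : actFirst A f =
      f.comp (Polynomial.X + Polynomial.C (scaleThird F (A 0 2))) := by
  have h : actThird A = AlgHom.id F F[X] := by
    refine Polynomial.algHom_ext ?_
    simp [actThird, h2]
  rw [actFirst, Polynomial.twist_eq_comp, h, h0, map_one, map_one, one_mul]
  exact congrArg (Polynomial.comp · _) (Polynomial.map_id)

open Polynomial in
lemma exists_monic_invariants {ρ : H →* Matrix (Fin 3) (Fin 3) F}
    (hρ : ∀ h, ρ h 0 1 = 0 ∧ ρ h 2 0 = 0 ∧ ρ h 2 1 = 0) {χ₀ χ₁ : H →* Fˣ}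
    (hχ₀ : ∀ h, ρ h 0 0 = χ₀ h) (hχ₁ : ∀ h, ρ h 1 1 = χ₁ h)
    (T : Subgroup H) [T.Normal] (hcard : (Nat.card (H ⧸ T) : F) ≠ 0)
    (M N : AddSubgroup F) [Finite M] [Finite N]
    (hT : ∀ t ∈ T, ∃ m ∈ M, ∃ n ∈ N, ρ t = upperMat m n) :
    (∃ f : F[X][X], f.Monic ∧ f.natDegree = Nat.card M ∧
      ∀ h, actFirst (ρ h) f = χ₀ h ^ Nat.card M • f) ∧
    (∃ f : F[X][X][X], f.Monic ∧ f.natDegree = Nat.card N ∧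
      ∀ h, actAll (ρ h) f = χ₁ h ^ Nat.card N • f) := by
  constructor
  · have := Polynomial.exists_monic_semiinvariant (fun h ↦ actThird (ρ h)) χ₀
      (fun h ↦ scaleThird F (ρ h 0 2)) (fun g h x ↦ by
        simp only [← hχ₀]
        rw [map_mul]
        exact actFirst_mul (hρ g) (hρ h) x) T hcard M (scaleThird F) (fun t ht ↦ by
        obtain ⟨m, hm, n, hn, h⟩ := hT t ht
        refine ⟨Units.ext ?_, fun x ↦ actThird_scaleThird ?_ x, m, hm, ?_⟩
        · rw [← hχ₀, h]; simp [upperMat]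
        · simp [h, upperMat]
        · simp [h, upperMat])
    simp only [← hχ₀] at this
    exact this
  · have := Polynomial.exists_monic_semiinvariant (fun h ↦ actFirst (ρ h)) χ₁
      (fun h ↦ Polynomial.C (Polynomial.C (ρ h 1 0)) * Polynomial.X +
        Polynomial.C (scaleThird F (ρ h 1 2))) (fun g h x ↦ by
        simp only [← hχ₁]
        rw [map_mul]
        exact actAll_mul (hρ g) (hρ h) x) T hcard N
      ((Polynomial.C : F[X] →+* F[X][X]).toAddMonoidHom.comp (scaleThird F)) (fun t ht ↦ by
        obtain ⟨m, hm, n, hn, h⟩ := hT t ht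
        refine ⟨Units.ext ?_, fun x ↦ ?_, n, hn, ?_⟩
        · rw [← hχ₁, h]; simp [upperMat]
        · simp [actFirst, actThird_scaleThird (A := ρ t) (by simp [h, upperMat])]
        · simp [h, upperMat])
    simp only [← hχ₁] at this
    exact this

open Polynomial in
/-- Substitution of monic semi-invariants for the first two variables. -/
def substPair (f₁ : F[X][X]) (f₂ : F[X][X][X]) : F[X][X][X] →+* F[X][X][X] :=
  (Polynomial.compRingHom f₂).comp (Polynomial.mapRingHom (Polynomial.compRingHom f₁))

open Polynomial in
lemma substPair_injective {f₁ : F[X][X]} {f₂ : F[X][X][X]} (h₁ : f₁.natDegree ≠ 0)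
    (h₂ : f₂.natDegree ≠ 0) : Function.Injective (substPair f₁ f₂) :=
  (Polynomial.comp_left_injective h₂).comp
    (Polynomial.map_injective _ (Polynomial.comp_left_injective h₁))

open Polynomial in
lemma exists_substPair_eq {f₁ : F[X][X]} {f₂ : F[X][X][X]} {M N : AddSubgroup F} [Finite M]
    [Finite N] (hf₁ : f₁.Monic) (hf₂ : f₂.Monic) (h₁ : f₁.natDegree = Nat.card M)
    (h₂ : f₂.natDegree = Nat.card N)
    (hf₁M : ∀ m ∈ M, f₁.comp (Polynomial.X + Polynomial.C (scaleThird F m)) = f₁)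
    (hf₂M : ∀ m ∈ M, f₂.map (Polynomial.compRingHom
      (Polynomial.X + Polynomial.C (scaleThird F m))) = f₂)
    (hf₂N : ∀ n ∈ N, f₂.comp (Polynomial.X + Polynomial.C (Polynomial.C (scaleThird F n))) = f₂)
    {g : F[X][X][X]}
    (hgM : ∀ m ∈ M, g.map (Polynomial.compRingHom
      (Polynomial.X + Polynomial.C (scaleThird F m))) = g)
    (hgN : ∀ n ∈ N, g.comp (Polynomial.X + Polynomial.C (Polynomial.C (scaleThird F n))) = g) :
    ∃ P, g = substPair f₁ f₂ P := by
  classical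
  have hinj : Function.Injective (scaleThird F) := fun x y h ↦ by
    simpa [scaleThird_apply] using h
  have hinjM : Function.Injective fun m : M ↦ scaleThird F m := hinj.comp Subtype.val_injective
  have hinjN : Function.Injective fun n : N ↦ Polynomial.C (scaleThird F n) :=
    Polynomial.C_injective.comp (hinj.comp Subtype.val_injective)
  have h₂0 : f₂.natDegree ≠ 0 := h₂ ▸ Nat.card_pos.ne'
  let _ := Fintype.ofFinite M
  let _ := Fintype.ofFinite N
  obtain ⟨h, hh⟩ := Polynomial.exists_comp_eq_of_comp_X_add_C hf₂ h₂0
    (Finset.univ.image fun n : N ↦ Polynomial.C (scaleThird F n)) (by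
      rw [Finset.card_image_of_injective _ hinjN, h₂, Nat.card_eq_fintype_card,
        Finset.card_univ]) (by simpa using hf₂N) g (by simpa using hgN)
  have hhM (m) (hm : m ∈ M) : h.map (Polynomial.compRingHom
      (Polynomial.X + Polynomial.C (scaleThird F m))) = h := by
    refine Polynomial.comp_left_injective h₂0 ?_
    change Polynomial.comp _ _ = Polynomial.comp _ _
    nth_rw 1 [← hf₂M m hm]
    rw [← Polynomial.map_comp, ← hh, hgM m hm]
  have hcoeff (k : ℕ) : h.coeff k ∈ Set.range (Polynomial.compRingHom f₁) := by
    obtain ⟨x, hx⟩ := Polynomial.exists_comp_eq_of_comp_X_add_C hf₁ (h₁ ▸ Nat.card_pos.ne')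
      (Finset.univ.image fun m : M ↦ scaleThird F m) (by
        rw [Finset.card_image_of_injective _ hinjM, h₁, Nat.card_eq_fintype_card,
          Finset.card_univ]) (by simpa using hf₁M) (h.coeff k) (by
        simp only [Finset.mem_image, Finset.mem_univ, true_and, Subtype.exists,
          forall_exists_index]
        rintro _ m hm rfl
        nth_rw 2 [← hhM m hm]
        rw [Polynomial.coeff_map, Polynomial.coe_compRingHom_apply])
    exact ⟨x, hx.symm⟩
  obtain ⟨P, hP⟩ := (Polynomial.lifts_iff_coeff_lifts h).mpr hcoeff
  refine ⟨P, ?_⟩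
  rw [hh, ← hP]
  rfl

/-- A block triangular group whose unipotent part acts by independent translations has algebraically
independent semi-invariants which generate the invariants of the unipotent part. -/
theorem exists_semiinvariants {ρ : H →* Matrix (Fin 3) (Fin 3) F}
    (hρ : ∀ h, ρ h 0 1 = 0 ∧ ρ h 2 0 = 0 ∧ ρ h 2 1 = 0) {χ₀ χ₁ χ₂ : H →* Fˣ}
    (hχ₀ : ∀ h, ρ h 0 0 = χ₀ h) (hχ₁ : ∀ h, ρ h 1 1 = χ₁ h) (hχ₂ : ∀ h, ρ h 2 2 = χ₂ h)
    (T : Subgroup H) [T.Normal] (hcard : (Nat.card (H ⧸ T) : F) ≠ 0)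
    (M N : AddSubgroup F) [Finite M] [Finite N]
    (hT : ∀ t ∈ T, ∃ m ∈ M, ∃ n ∈ N, ρ t = upperMat m n)
    (hMN : ∀ m ∈ M, ∀ n ∈ N, ∃ t, ρ t = upperMat m n) :
    ∃ y : Fin 3 → MvPolynomial (Fin 3) F,
      Function.Injective (aeval y : MvPolynomial (Fin 3) F →ₐ[F] MvPolynomial (Fin 3) F) ∧
      (∀ h i, polyAct (ρ h) (y i) =
        (![χ₀ ^ Nat.card M, χ₁ ^ Nat.card N, χ₂] i h : F) • y i) ∧
      ∀ f : MvPolynomial (Fin 3) F, (∀ h, polyAct (ρ h) f = f) →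
        ∃ P : MvPolynomial (Fin 3) F, f = aeval y P := by
  obtain ⟨⟨f₁, hf₁, h₁, hact₁⟩, f₂, hf₂, h₂, hact₂⟩ :=
    exists_monic_invariants hρ hχ₀ hχ₁ T hcard M N hT
  let Θ := iteratedEquiv F
  let y : Fin 3 → MvPolynomial (Fin 3) F := ![Θ.symm (Polynomial.C f₁), Θ.symm f₂, X 2]
  have hy (P) : Θ (aeval y P) = substPair f₁ f₂ (Θ P) := by
    have : (Θ : MvPolynomial (Fin 3) F →+* _).comp (aeval y).toRingHom =
        (substPair f₁ f₂).comp (Θ : MvPolynomial (Fin 3) F →+* _) := by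
      refine MvPolynomial.ringHom_ext (fun r ↦ ?_) fun i ↦ ?_
      · simp [substPair, Θ, algebraMap_eq]
      · fin_cases i <;> simp [substPair, Θ, y]
    exact DFunLike.congr_fun this P
  have htrans {m n : F} (hm : m ∈ M) (hn : n ∈ N) (f : Polynomial (Polynomial (Polynomial F)))
      (hf : ∀ h, χ₀ h = 1 → χ₁ h = 1 → actAll (ρ h) f = f) : actAll (upperMat m n) f = f := by
    obtain ⟨t, ht⟩ := hMN m hm n hn
    rw [← ht]
    refine hf t (Units.ext ?_) (Units.ext ?_)
    · rw [← hχ₀, ht]; simp [upperMat]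
    · rw [← hχ₁, ht]; simp [upperMat]
  have htransM (f : Polynomial (Polynomial (Polynomial F)))
      (hf : ∀ h, χ₀ h = 1 → χ₁ h = 1 → actAll (ρ h) f = f) (m) (hm : m ∈ M) :
      f.map (Polynomial.compRingHom
        (Polynomial.X + Polynomial.C (scaleThird F m))) = f := by
    have h := htrans hm (zero_mem N) f hf
    have h' : (actFirst (upperMat m 0) : _ →+* _) = Polynomial.compRingHom
        (Polynomial.X + Polynomial.C (scaleThird F m)) := RingHom.ext fun x ↦
      actFirst_eq_comp (A := upperMat m 0) (by simp [upperMat]) (by simp [upperMat]) x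
    rw [actAll, Polynomial.twist_eq_comp, h'] at h
    simpa [upperMat] using h
  have htransN (f : Polynomial (Polynomial (Polynomial F)))
      (hf : ∀ h, χ₀ h = 1 → χ₁ h = 1 → actAll (ρ h) f = f) (n) (hn : n ∈ N) :
      f.comp (Polynomial.X + Polynomial.C (Polynomial.C (scaleThird F n))) = f := by
    have h := htrans (zero_mem M) hn f hf
    have h' : (actFirst (upperMat 0 n) : _ →+* _) = RingHom.id _ := RingHom.ext fun x ↦
      (actFirst_eq_comp (A := upperMat 0 n) (by simp [upperMat]) (by simp [upperMat]) x).trans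
        (by simp [upperMat])
    rw [actAll, Polynomial.twist_eq_comp, h', Polynomial.map_id] at h
    simpa [upperMat, scaleThird_apply] using h
  have hf₂' (h) (_ : χ₀ h = 1) (h1 : χ₁ h = 1) : actAll (ρ h) f₂ = f₂ := by
    rw [hact₂, h1, one_pow, one_smul]
  refine ⟨y, fun P P' h ↦ ?_, fun h i ↦ ?_, fun f hf ↦ ?_⟩
  · refine Θ.injective (substPair_injective (f₁ := f₁) (f₂ := f₂) (h₁ ▸ Nat.card_pos.ne')
      (h₂ ▸ Nat.card_pos.ne') ?_)
    rw [← hy, ← hy]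
    exact congrArg Θ h
  · refine Θ.injective ?_
    rw [iteratedEquiv_polyAct (hρ h).1 (hρ h).2.1 (hρ h).2.2, map_smul]
    fin_cases i
    · simp [y, Θ, actAll, hact₁]
      rw [Units.smul_def, Units.val_pow_eq_pow_val]
    · simp [y, Θ, hact₂]
      rw [Units.smul_def, Units.val_pow_eq_pow_val]
    · simp [y, Θ, actAll, actFirst, actThird, hχ₂, Algebra.smul_def]
  · obtain ⟨P, hP⟩ := exists_substPair_eq (g := Θ f) hf₁ hf₂ h₁ h₂ (fun m hm ↦ by
      obtain ⟨t, ht⟩ := hMN m hm 0 (zero_mem N)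
      have := hact₁ t
      rw [show χ₀ t = 1 from Units.ext (by rw [← hχ₀, ht]; simp [upperMat]), one_pow, one_smul,
        actFirst_eq_comp (by rw [ht]; simp [upperMat]) (by rw [ht]; simp [upperMat]), ht] at this
      simpa [upperMat] using this) (htransM f₂ hf₂') (htransN f₂ hf₂')
      (htransM _ fun h _ _ ↦ by
        rw [← iteratedEquiv_polyAct (hρ h).1 (hρ h).2.1 (hρ h).2.2, hf])
      (htransN _ fun h _ _ ↦ by
        rw [← iteratedEquiv_polyAct (hρ h).1 (hρ h).2.1 (hρ h).2.2, hf])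
    refine ⟨Θ.symm P, Θ.injective ?_⟩
    rw [hy, AlgEquiv.apply_symm_apply, hP]

end BlockInvariants

section Semiinvariants
variable {F : Type u} [Field F]

lemma coeff_aeval_smul_X (l : Fin 3 → F) (P : MvPolynomial (Fin 3) F) (m : Fin 3 →₀ ℕ) :
    coeff m (aeval (fun i ↦ l i • (X i : MvPolynomial (Fin 3) F)) P) =
      (∏ i, l i ^ m i) * coeff m P := by
  classical
  induction P using MvPolynomial.induction_on' with
  | monomial k r =>
    have : aeval (fun i ↦ l i • (X i : MvPolynomial (Fin 3) F)) (monomial k r) =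
        (∏ i, l i ^ k i) • monomial k r := by
      rw [aeval_monomial, Finsupp.prod_fintype _ _ (by simp)]
      simp only [Algebra.smul_def, mul_pow, Finset.prod_mul_distrib, monomial_eq, map_prod,
        map_pow, algebraMap_eq]
      rw [Finsupp.prod_fintype _ _ (by simp), mul_left_comm]
    rw [this, coeff_smul, coeff_monomial, smul_eq_mul]
    split_ifs with h
    · rw [h]
    · simp
  | add P Q hP hQ => rw [map_add, coeff_add, hP, hQ, coeff_add, mul_add]

lemma mem_invariantRing {G : Subgroup (Matrix.SpecialLinearGroup (Fin 3) F)}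
    {f : MvPolynomial (Fin 3) F} :
    f ∈ invariantRing G ↔ ∀ g : G, polyAct (g : Matrix (Fin 3) (Fin 3) F) f = f := by
  constructor
  · intro h g
    exact h _ ⟨g, g.2, rfl⟩
  · rintro h _ ⟨g, hg, rfl⟩
    exact h ⟨g, hg⟩

lemma weightHom_ofMul_eq_zero_iff {H : Type*} [Group H] (ψ : Fin 3 → H →* Fˣ) (m : Fin 3 →₀ ℕ) :
    weightHom (fun i ↦ Additive.ofMul (ψ i)) m = 0 ↔
      ∀ h, ∏ i, (ψ i h : F) ^ m i = 1 := by
  rw [weightHom_apply]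
  simp only [← ofMul_pow, ← ofMul_mul, ofMul_eq_zero, DFunLike.ext_iff, Units.ext_iff,
    Fin.prod_univ_three]
  simp

/-- Independent semi-invariants generating a ring which contains the invariants identify the
invariants with the polynomials of weight zero. -/
lemma nonempty_weightZero_ringEquiv (G : Subgroup (Matrix.SpecialLinearGroup (Fin 3) F))
    (ψ : Fin 3 → G →* Fˣ) (y : Fin 3 → MvPolynomial (Fin 3) F)
    (hy : Function.Injective (aeval y : MvPolynomial (Fin 3) F →ₐ[F] MvPolynomial (Fin 3) F))
    (hψ : ∀ (g : G) i, polyAct (g : Matrix (Fin 3) (Fin 3) F) (y i) = (ψ i g : F) • y i)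
    (hG : ∀ f ∈ invariantRing G, ∃ P : MvPolynomial (Fin 3) F, f = aeval y P) :
    Nonempty (weightZero F (weightHom fun i ↦ Additive.ofMul (ψ i)) ≃+* invariantRing G) := by
  have hact (g : G) (P : MvPolynomial (Fin 3) F) :
      polyAct (g : Matrix (Fin 3) (Fin 3) F) (aeval y P) =
        aeval y (aeval (fun i ↦ (ψ i g : F) • (X i : MvPolynomial (Fin 3) F)) P) := by
    rw [← AlgHom.comp_apply, ← AlgHom.comp_apply]
    congr 1
    refine MvPolynomial.algHom_ext fun i ↦ ?_
    simp [hψ]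
  have hmem (P : MvPolynomial (Fin 3) F) : aeval y P ∈ invariantRing G ↔
      P ∈ weightZero F (weightHom fun i ↦ Additive.ofMul (ψ i)) := by
    rw [mem_invariantRing]
    simp only [hact, hy.eq_iff, MvPolynomial.ext_iff, coeff_aeval_smul_X]
    change _ ↔ ∀ m, coeff m P ≠ 0 → weightHom (fun i ↦ Additive.ofMul (ψ i)) m = 0
    rw [forall_comm]
    refine forall_congr' fun m ↦ ?_
    rw [weightHom_ofMul_eq_zero_iff]
    by_cases h : coeff m P = 0
    · simp [h]
    · simp [h]
  refine ⟨RingEquiv.ofBijective (((aeval y).comp (weightZero F _).val).codRestrict _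
    fun P ↦ (hmem P).mpr P.2) ⟨fun P Q h ↦ ?_, fun f ↦ ?_⟩⟩
  · exact Subtype.ext (hy (congrArg Subtype.val h))
  · obtain ⟨P, hP⟩ := hG f f.2
    exact ⟨⟨P, (hmem P).mp (hP ▸ f.2)⟩, Subtype.ext hP.symm⟩

lemma exists_coprime_pow_eq_one (p : ℕ) [Fact p.Prime] [CharP F p] (H : Type*) [Group H]
    [Finite H] : ∃ e, 0 < e ∧ p.Coprime e ∧ ∀ χ : H →* Fˣ, χ ^ e = 1 := by
  have hp : p.Prime := Fact.out
  obtain ⟨k, e, he, hcard⟩ :=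
    Nat.exists_eq_pow_mul_and_not_dvd (Nat.card_pos (α := H)).ne' p hp.ne_one
  refine ⟨e, Nat.pos_of_ne_zero fun h ↦ he (h ▸ dvd_zero p), (hp.coprime_iff_not_dvd).mpr he,
    fun χ ↦ MonoidHom.ext fun h ↦ Units.ext ?_⟩
  rw [MonoidHom.pow_apply, Units.val_pow_eq_pow_val, MonoidHom.one_apply, Units.val_one,
    ← ExpChar.pow_prime_pow_mul_eq_one_iff p k, ← hcard, ← Units.val_pow_eq_pow_val, ← map_pow,
    pow_card_eq_one', map_one, Units.val_one]

lemma cast_card_quotient_ker_ne_zero (p : ℕ) [Fact p.Prime] [CharP F p] {H ι : Type*} [Group H]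
    [Finite H] (χ : ι → H →* Fˣ) (T : Subgroup H) [T.Normal]
    (hT : ∀ h, h ∈ T ↔ ∀ i, χ i h = 1) : (Nat.card (H ⧸ T) : F) ≠ 0 := by
  rw [Ne, CharP.cast_eq_zero_iff F p]
  intro h
  obtain ⟨x, hx⟩ := exists_prime_orderOf_dvd_card' p h
  obtain ⟨g, rfl⟩ := QuotientGroup.mk_surjective x
  have hg : g ^ p ∈ T := by
    rw [← QuotientGroup.eq_one_iff, QuotientGroup.mk_pow, ← hx, pow_orderOf_eq_one]
  have hgT : g ∈ T := (hT g).mpr fun i ↦ Units.ext <| by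
    have := congrArg Units.val ((hT _).mp hg i)
    rw [map_pow, Units.val_pow_eq_pow_val, Units.val_one] at this
    simpa using (ExpChar.pow_prime_pow_mul_eq_one_iff p 1 1 (χ i g : F)).mp (by simpa using this)
  rw [(QuotientGroup.eq_one_iff g).mpr hgT, orderOf_one] at hx
  exact (Fact.out : p.Prime).ne_one hx.symm

/-- The Gorenstein criterion for a group conjugate to a block triangular one whose unipotent part
acts by independent translations. -/
theorem isGorensteinRing_invariantRing_iff (p : ℕ) [Fact p.Prime] [CharP F p]
    (G : Subgroup (Matrix.SpecialLinearGroup (Fin 3) F)) [Finite G]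
    {A B : Matrix (Fin 3) (Fin 3) F} (hAB : A * B = 1) (hBA : B * A = 1)
    {χ₀ χ₁ χ₂ : G →* Fˣ} {r s t : G → F}
    (hA : ∀ g : G, A * g = !![(χ₀ g : F), 0, r g; s g, χ₁ g, t g; 0, 0, χ₂ g] * A)
    (hχ : χ₀ * χ₁ * χ₂ = 1) (M N : AddSubgroup F) {n₁ n₂ : ℕ} (hM : Nat.card M = p ^ n₁)
    (hN : Nat.card N = p ^ n₂)
    (hT : ∀ g : G, χ₀ g = 1 → χ₁ g = 1 → χ₂ g = 1 → s g = 0 ∧ r g ∈ M ∧ t g ∈ N)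
    (hMN : ∀ m ∈ M, ∀ n ∈ N, ∃ g : G, A * (g : Matrix (Fin 3) (Fin 3) F) = upperMat m n * A) :
    IsGorensteinRing (invariantRing G) ↔
      ∀ g : G, (χ₀ g : F) ^ p ^ n₁ * (χ₁ g : F) ^ p ^ n₂ * χ₂ g = 1 := by
  have hp : p.Prime := Fact.out
  have : Finite M := Nat.finite_of_card_ne_zero (by rw [hM]; exact pow_ne_zero _ hp.ne_zero)
  have : Finite N := Nat.finite_of_card_ne_zero (by rw [hN]; exact pow_ne_zero _ hp.ne_zero)
  let ρ : G →* Matrix (Fin 3) (Fin 3) F :=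
    { toFun g := A * g * B
      map_one' := by simp [hAB]
      map_mul' g h := by
        change A * ((g : Matrix (Fin 3) (Fin 3) F) * h) * B = A * g * B * (A * h * B)
        simp only [mul_assoc]
        rw [← mul_assoc B A, hBA, one_mul] }
  have hρ (g : G) : ρ g = !![(χ₀ g : F), 0, r g; s g, χ₁ g, t g; 0, 0, χ₂ g] := by
    change A * g * B = _
    rw [hA, mul_assoc, hAB, mul_one]
  have hρA (g : G) : ρ g * A = A * g := by rw [hρ, hA]
  let T : Subgroup G := χ₀.ker ⊓ χ₁.ker ⊓ χ₂.ker
  have hcard : (Nat.card (G ⧸ T) : F) ≠ 0 :=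
    cast_card_quotient_ker_ne_zero p ![χ₀, χ₁, χ₂] T fun g ↦ by
      simp [T, Subgroup.mem_inf, MonoidHom.mem_ker, Fin.forall_fin_succ, and_assoc]
  obtain ⟨y, hy, hψ, hG⟩ := exists_semiinvariants (ρ := ρ) (χ₀ := χ₀) (χ₁ := χ₁) (χ₂ := χ₂)
    (fun g ↦ by simp [hρ])
    (fun g ↦ by simp [hρ]) (fun g ↦ by simp [hρ]) (fun g ↦ by simp [hρ]) T hcard M N
    (fun g hg ↦ by
      simp only [T, Subgroup.mem_inf, MonoidHom.mem_ker] at hg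
      obtain ⟨h1, h2, h3⟩ := hT g hg.1.1 hg.1.2 hg.2
      exact ⟨_, h2, _, h3, by simp [hρ, hg, h1, upperMat]⟩)
    (fun m hm n hn ↦ by
      obtain ⟨g, hg⟩ := hMN m hm n hn
      exact ⟨g, by change A * g * B = _; rw [hg, mul_assoc, hAB, mul_one]⟩)
  have hactA (g : G) (f : MvPolynomial (Fin 3) F) :
      polyAct (g : Matrix (Fin 3) (Fin 3) F) (polyAct A f) = polyAct A (polyAct (ρ g) f) := by
    rw [← polyAct_mul, ← polyAct_mul, hρA]
  have hone (f : MvPolynomial (Fin 3) F) : polyAct 1 f = f := by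
    have : polyAct (1 : Matrix (Fin 3) (Fin 3) F) = AlgHom.id F _ := by
      refine MvPolynomial.algHom_ext fun i ↦ ?_
      simp [polyAct, Matrix.one_apply]
    rw [this, AlgHom.id_apply]
  have hAinj : Function.Injective (polyAct A) :=
    Function.LeftInverse.injective (g := polyAct B) fun f ↦ by rw [← polyAct_mul, hAB, hone]
  have hyA (P : MvPolynomial (Fin 3) F) :
      aeval (fun i ↦ polyAct A (y i)) P = polyAct A (aeval y P) := by
    rw [← AlgHom.comp_apply]
    congr 1
    refine MvPolynomial.algHom_ext fun i ↦ ?_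
    simp
  obtain ⟨E⟩ := nonempty_weightZero_ringEquiv G ![χ₀ ^ Nat.card M, χ₁ ^ Nat.card N, χ₂]
    (fun i ↦ polyAct A (y i)) (fun P Q h ↦ hy (hAinj (by rw [← hyA, ← hyA, h])))
    (fun g i ↦ by rw [hactA, hψ, map_smul]) (fun f hf ↦ by
      obtain ⟨P, hP⟩ := hG (polyAct B f) fun g ↦ hAinj (by
        rw [← hactA, ← polyAct_mul B A, hBA, hone, mem_invariantRing.mp hf])
      exact ⟨P, by rw [hyA, ← hP, ← polyAct_mul, hBA, hone]⟩)
  obtain ⟨e, he, hpe, hχe⟩ := exists_coprime_pow_eq_one (F := F) p G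
  let γ : Fin 3 → Additive (G →* Fˣ) := fun i ↦ Additive.ofMul (![χ₀, χ₁, χ₂] i)
  have hγ : (fun i ↦ Additive.ofMul (![χ₀ ^ Nat.card M, χ₁ ^ Nat.card N, χ₂] i)) =
      ![p ^ n₁ • γ 0, p ^ n₂ • γ 1, γ 2] := by
    funext i
    rw [hM, hN]
    fin_cases i <;> rfl
  rw [hγ] at E
  have key := isGorensteinRing_weightZero_iff_of_coprime (F := F) γ hχ he (fun i ↦ hχe _)
    (hpe.pow_left n₁) (hpe.pow_left n₂)
  rw [← (⟨IsGorensteinRing.of_ringEquiv E, IsGorensteinRing.of_ringEquiv E.symm⟩ :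
    IsGorensteinRing _ ↔ IsGorensteinRing _), key]
  simp only [γ, ← ofMul_pow, ← ofMul_mul, ofMul_eq_zero, DFunLike.ext_iff, Units.ext_iff]
  simp

end Semiinvariants

section Transvections
variable {F : Type u} [Field F]

/-- The unipotent matrices fixing the third basis vector and the quotient by it, in `SL₃`. -/
def upperSL (x y : F) : Matrix.SpecialLinearGroup (Fin 3) F :=
  ⟨upperMat x y, by simp [upperMat, Matrix.det_fin_three]⟩

@[simp]
lemma coe_upperSL (x y : F) : (upperSL x y : Matrix (Fin 3) (Fin 3) F) = upperMat x y := rfl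

lemma upperMat_zero : upperMat (0 : F) 0 = 1 := by
  ext i j
  fin_cases i <;> fin_cases j <;> simp [upperMat]

lemma upperMat_mul (x y x' y' : F) :
    upperMat x y * upperMat x' y' = upperMat (x + x') (y + y') := by
  ext i j
  fin_cases i <;> fin_cases j <;> simp [upperMat, Matrix.mul_apply, Fin.sum_univ_three, add_comm]

lemma upperSL_mul (x y x' y' : F) :
    upperSL x y * upperSL x' y' = upperSL (x + x') (y + y') :=
  Subtype.ext (upperMat_mul x y x' y')

lemma upperSL_zero : upperSL (0 : F) 0 = 1 := Subtype.ext upperMat_zero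

lemma upperSL_inv (x y : F) : (upperSL x y)⁻¹ = upperSL (-x) (-y) := by
  rw [inv_eq_iff_mul_eq_one, upperSL_mul, add_neg_cancel, add_neg_cancel, upperSL_zero]

lemma upperSL_injective {x y x' y' : F} (h : upperSL x y = upperSL x' y') : x = x' ∧ y = y' := by
  have h' := congrArg (Subtype.val) h
  exact ⟨congrFun₂ h' 0 2, congrFun₂ h' 1 2⟩

lemma isTransvectionMat_upperMat {x y : F} (h : ¬ (x = 0 ∧ y = 0)) :
    IsTransvectionMat (upperMat x y) := by
  have heq : upperMat x y - 1 = vecMulVec ![x, y, 0] ![0, 0, 1] := by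
    ext i j
    fin_cases i <;> fin_cases j <;> simp [upperMat, vecMulVec_apply]
  refine ⟨le_antisymm (heq ▸ rank_vecMulVec_le _ _) ?_, ?_⟩
  · rw [Nat.one_le_iff_ne_zero, Ne, Matrix.rank, Submodule.finrank_eq_zero, LinearMap.range_eq_bot]
    intro h0
    have h1 := LinearMap.congr_fun h0 (Pi.single 2 1)
    exact h ⟨by simpa [upperMat] using congrFun h1 0, by simpa [upperMat] using congrFun h1 1⟩
  · rw [heq]
    ext i j
    fin_cases i <;> fin_cases j <;> simp [Matrix.mul_apply, Fin.sum_univ_three]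

/-- The subgroup of `SL₃` of translations along two directions. -/
def translationSubgroup (a b c d : F) (M N : AddSubgroup F) :
    Subgroup (Matrix.SpecialLinearGroup (Fin 3) F) where
  carrier := {g | ∃ m ∈ M, ∃ n ∈ N, g = upperSL (a * m + c * n) (b * m + d * n)}
  one_mem' := ⟨0, M.zero_mem, 0, N.zero_mem, by simp [upperSL_zero]⟩
  mul_mem' := by
    rintro _ _ ⟨m, hm, n, hn, rfl⟩ ⟨m', hm', n', hn', rfl⟩
    refine ⟨m + m', add_mem hm hm', n + n', add_mem hn hn', ?_⟩
    rw [upperSL_mul]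
    congr 1 <;> ring
  inv_mem' := by
    rintro _ ⟨m, hm, n, hn, rfl⟩
    refine ⟨-m, neg_mem hm, -n, neg_mem hn, ?_⟩
    rw [upperSL_inv]
    congr 1 <;> ring

lemma upperSL_mem_of_mem_closure {G : Subgroup (Matrix.SpecialLinearGroup (Fin 3) F)} {a b : F}
    {s : Set F} (hs : ∀ m ∈ s, upperSL (a * m) (b * m) ∈ G) {m : F}
    (hm : m ∈ AddSubgroup.closure s) : upperSL (a * m) (b * m) ∈ G := by
  induction hm using AddSubgroup.closure_induction with
  | mem x hx => exact hs x hx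
  | zero => simp [upperSL_zero]
  | add x y _ _ hx hy => simpa [upperSL_mul, mul_add] using mul_mem hx hy
  | neg x _ hx => simpa [upperSL_inv] using inv_mem hx

lemma upperSL_mem_iff {G : Subgroup (Matrix.SpecialLinearGroup (Fin 3) F)} {a b c d : F}
    {ι κ : Type*} {μ : ι → F} {α : κ → F}
    (hTG : transSubgroup G = Subgroup.closure
      ({g : Matrix.SpecialLinearGroup (Fin 3) F |
          ∃ i, (g : Matrix (Fin 3) (Fin 3) F) = upperMat (a * μ i) (b * μ i)} ∪
        {g : Matrix.SpecialLinearGroup (Fin 3) F |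
          ∃ j, (g : Matrix (Fin 3) (Fin 3) F) = upperMat (c * α j) (d * α j)})) (x y : F) :
    upperSL x y ∈ G ↔ ∃ m ∈ AddSubgroup.closure (Set.range μ),
      ∃ n ∈ AddSubgroup.closure (Set.range α), x = a * m + c * n ∧ y = b * m + d * n := by
  constructor
  · intro h
    by_cases h0 : x = 0 ∧ y = 0
    · exact ⟨0, zero_mem _, 0, zero_mem _, by simp [h0]⟩
    have hT : upperSL x y ∈ transSubgroup G :=
      Subgroup.subset_closure ⟨h, isTransvectionMat_upperMat h0⟩
    have hle : transSubgroup G ≤ translationSubgroup a b c d (AddSubgroup.closure (Set.range μ))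
        (AddSubgroup.closure (Set.range α)) := by
      rw [hTG, Subgroup.closure_le]
      rintro g (⟨i, hi⟩ | ⟨j, hj⟩)
      · exact ⟨μ i, AddSubgroup.subset_closure ⟨i, rfl⟩, 0, zero_mem _, Subtype.ext <| by
          simp [hi]⟩
      · exact ⟨0, zero_mem _, α j, AddSubgroup.subset_closure ⟨j, rfl⟩, Subtype.ext <| by
          simp [hj]⟩
    obtain ⟨m, hm, n, hn, h⟩ := hle hT
    exact ⟨m, hm, n, hn, upperSL_injective h⟩
  · have hle : transSubgroup G ≤ G := (Subgroup.closure_le _).mpr fun _ h ↦ h.1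
    rw [hTG] at hle
    rintro ⟨m, hm, n, hn, rfl, rfl⟩
    rw [← upperSL_mul]
    refine mul_mem (upperSL_mem_of_mem_closure ?_ hm) (upperSL_mem_of_mem_closure ?_ hn)
    · rintro _ ⟨i, rfl⟩
      exact hle (Subgroup.subset_closure (Or.inl ⟨i, rfl⟩))
    · rintro _ ⟨j, rfl⟩
      exact hle (Subgroup.subset_closure (Or.inr ⟨j, rfl⟩))

lemma card_closure_range (p : ℕ) [Fact p.Prime] [CharP F p] {n : ℕ} {μ : Fin n → F}
    (hμ : ∀ e : Fin n → ℕ, ∑ i, (e i : F) * μ i = 0 → ∀ i, p ∣ e i) :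
    Nat.card (AddSubgroup.closure (Set.range μ)) = p ^ n := by
  let _ : Algebra (ZMod p) F := ZMod.algebra F p
  have hli : LinearIndependent (ZMod p) μ := by
    rw [Fintype.linearIndependent_iff]
    intro g hg i
    rw [← ZMod.natCast_zmod_val (g i), ZMod.natCast_eq_zero_iff]
    refine hμ (fun i ↦ (g i).val) ?_ i
    rw [← hg]
    refine Finset.sum_congr rfl fun j _ ↦ ?_
    rw [Algebra.smul_def, ← ZMod.natCast_zmod_val (g j), map_natCast, ZMod.natCast_zmod_val]
  have hspan : (Submodule.span (ZMod p) (Set.range μ)).toAddSubgroup =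
      AddSubgroup.closure (Set.range μ) := by
    refine le_antisymm ?_ ((AddSubgroup.closure_le _).mpr Submodule.subset_span)
    exact (Submodule.span_le (p := AddSubgroup.toZModSubmodule p
      (AddSubgroup.closure (Set.range μ)))).mpr AddSubgroup.subset_closure
  rw [← hspan]
  change Nat.card (Submodule.span (ZMod p) (Set.range μ)) = _
  have := FiniteDimensional.span_of_finite (ZMod p) (Set.finite_range μ)
  rw [Module.natCard_eq_pow_finrank (K := ZMod p), finrank_span_eq_card hli, Nat.card_zmod,
    Fintype.card_fin]

end Transvections

section BlockGroup
variable {F : Type u} [Field F]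

lemma exists_diagonal_characters {G : Subgroup (Matrix.SpecialLinearGroup (Fin 3) F)}
    (hblock : ∀ g ∈ G, (g : Matrix (Fin 3) (Fin 3) F) 0 1 = 0 ∧
      (g : Matrix (Fin 3) (Fin 3) F) 1 0 = 0 ∧ (g : Matrix (Fin 3) (Fin 3) F) 2 0 = 0 ∧
      (g : Matrix (Fin 3) (Fin 3) F) 2 1 = 0) :
    ∃ l : Fin 3 → G →* Fˣ, ∀ i (g : G), (l i g : F) = (g : Matrix (Fin 3) (Fin 3) F) i i := by
  have hmul (i) (g h : G) : ((g * h : G) : Matrix (Fin 3) (Fin 3) F) i i =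
      (g : Matrix (Fin 3) (Fin 3) F) i i * (h : Matrix (Fin 3) (Fin 3) F) i i := by
    change ((g : Matrix (Fin 3) (Fin 3) F) * (h : Matrix (Fin 3) (Fin 3) F)) i i = _
    obtain ⟨g1, g2, g3, g4⟩ := hblock g g.2
    obtain ⟨h1, h2, h3, h4⟩ := hblock h h.2
    fin_cases i <;> simp [Matrix.mul_apply, Fin.sum_univ_three, g1, g2, g3, g4, h3, h4]
  exact ⟨fun i ↦ MonoidHom.toHomUnits
    { toFun g := (g : Matrix (Fin 3) (Fin 3) F) i i
      map_one' := by simp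
      map_mul' := hmul i }, fun i g ↦ rfl⟩

lemma diagonal_prod_eq_one {g : Matrix.SpecialLinearGroup (Fin 3) F}
    (h : (g : Matrix (Fin 3) (Fin 3) F) 0 1 = 0 ∧
      (g : Matrix (Fin 3) (Fin 3) F) 1 0 = 0 ∧ (g : Matrix (Fin 3) (Fin 3) F) 2 0 = 0 ∧
      (g : Matrix (Fin 3) (Fin 3) F) 2 1 = 0) :
    (g : Matrix (Fin 3) (Fin 3) F) 0 0 * (g : Matrix (Fin 3) (Fin 3) F) 1 1 *
      (g : Matrix (Fin 3) (Fin 3) F) 2 2 = 1 := by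
  have := g.det_coe
  rw [Matrix.det_fin_three] at this
  simpa [h] using this

variable {G : Subgroup (Matrix.SpecialLinearGroup (Fin 3) F)} {a b c d : F} {M N : AddSubgroup F}

/-- The Gorenstein criterion in coordinates adapted to the two directions of translation, given the
characters by which the group acts on these coordinates. -/
lemma isGorensteinRing_invariantRing_iff_of_characters (p : ℕ) [Fact p.Prime] [CharP F p]
    [Finite G] (hblock : ∀ g ∈ G, (g : Matrix (Fin 3) (Fin 3) F) 0 1 = 0 ∧
      (g : Matrix (Fin 3) (Fin 3) F) 1 0 = 0 ∧ (g : Matrix (Fin 3) (Fin 3) F) 2 0 = 0 ∧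
      (g : Matrix (Fin 3) (Fin 3) F) 2 1 = 0)
    (hΔ : a * d - b * c ≠ 0) {n₁ n₂ : ℕ} (hM : Nat.card M = p ^ n₁) (hN : Nat.card N = p ^ n₂)
    (hG : ∀ x y, upperSL x y ∈ G ↔ ∃ m ∈ M, ∃ n ∈ N, x = a * m + c * n ∧ y = b * m + d * n)
    {χ₀ χ₁ χ₂ : G →* Fˣ} {s : G → F}
    (hχ₂ : ∀ g : G, (χ₂ g : F) = (g : Matrix (Fin 3) (Fin 3) F) 2 2)
    (hd : ∀ g : G, d * (g : Matrix (Fin 3) (Fin 3) F) 0 0 = χ₀ g * d)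
    (hc : ∀ g : G, c * (g : Matrix (Fin 3) (Fin 3) F) 1 1 = χ₀ g * c)
    (hsd : ∀ g : G, s g * d = b * (χ₁ g - (g : Matrix (Fin 3) (Fin 3) F) 0 0))
    (hsc : ∀ g : G, s g * c = a * (χ₁ g - (g : Matrix (Fin 3) (Fin 3) F) 1 1))
    (hχ : ∀ g : G, (χ₀ g : F) * χ₁ g = (g : Matrix (Fin 3) (Fin 3) F) 0 0 *
      (g : Matrix (Fin 3) (Fin 3) F) 1 1)
    (hone : ∀ g : G, χ₀ g = 1 → χ₁ g = 1 → (g : Matrix (Fin 3) (Fin 3) F) 0 0 = 1 ∧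
      (g : Matrix (Fin 3) (Fin 3) F) 1 1 = 1) :
    IsGorensteinRing (invariantRing G) ↔
      ∀ g : G, (χ₀ g : F) ^ p ^ n₁ * (χ₁ g : F) ^ p ^ n₂ * χ₂ g = 1 := by
  have hAB : !![d, -c, 0; -b, a, 0; 0, 0, a * d - b * c] *
      ((a * d - b * c)⁻¹ • !![a, c, 0; b, d, 0; 0, 0, 1]) = 1 := by
    rw [mul_smul_comm, inv_smul_eq_iff₀ hΔ]
    ext i j
    fin_cases i <;> fin_cases j <;> simp [Matrix.mul_apply, Fin.sum_univ_three] <;> ring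
  refine isGorensteinRing_invariantRing_iff p G
    (A := !![d, -c, 0; -b, a, 0; 0, 0, a * d - b * c])
    (B := (a * d - b * c)⁻¹ • !![a, c, 0; b, d, 0; 0, 0, 1])
    (r := fun g ↦ (d * (g : Matrix (Fin 3) (Fin 3) F) 0 2 -
      c * (g : Matrix (Fin 3) (Fin 3) F) 1 2) / (a * d - b * c))
    (t := fun g ↦ (a * (g : Matrix (Fin 3) (Fin 3) F) 1 2 -
      b * (g : Matrix (Fin 3) (Fin 3) F) 0 2) / (a * d - b * c)) (s := s)
    hAB (mul_eq_one_comm.mp hAB) (fun g ↦ ?_) ?_ M N hM hN (fun g h0 h1 h2 ↦ ?_) fun m hm n hn ↦ ?_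
  · obtain ⟨g1, g2, g3, g4⟩ := hblock g g.2
    ext i j
    fin_cases i <;> fin_cases j <;>
      simp [Matrix.mul_apply, Fin.sum_univ_three, g1, g2, g3, g4, hχ₂, hΔ]
    · exact hd g
    · linear_combination hc g
    · ring
    · linear_combination -hsd g
    · linear_combination hsc g
    · ring
    · ring
  · refine MonoidHom.ext fun g ↦ Units.ext ?_
    simp only [MonoidHom.mul_apply, Units.val_mul, MonoidHom.one_apply, Units.val_one, hχ, hχ₂]
    exact diagonal_prod_eq_one (hblock g g.2)
  · obtain ⟨g00, g11⟩ := hone g h0 h1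
    obtain ⟨g1, g2, g3, g4⟩ := hblock g g.2
    have g22 := hχ₂ g
    rw [h2, Units.val_one] at g22
    have hg : (g : Matrix.SpecialLinearGroup (Fin 3) F) =
        upperSL ((g : Matrix (Fin 3) (Fin 3) F) 0 2) ((g : Matrix (Fin 3) (Fin 3) F) 1 2) := by
      ext i j
      fin_cases i <;> fin_cases j <;> simp [upperMat, *]
    obtain ⟨m, hm, n, hn, hx, hy⟩ := (hG _ _).mp (hg ▸ g.2)
    refine ⟨?_, ?_, ?_⟩
    · have hsd := hsd g
      have hsc := hsc g
      rw [h1, g00, Units.val_one, sub_self, mul_zero] at hsd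
      rw [h1, g11, Units.val_one, sub_self, mul_zero] at hsc
      refine (mul_eq_zero.mp (?_ : s g * (a * d - b * c) = 0)).resolve_right hΔ
      linear_combination a * hsd - b * hsc
    · convert hm using 1
      rw [div_eq_iff hΔ, hx, hy]
      ring
    · convert hn using 1
      rw [div_eq_iff hΔ, hx, hy]
      ring
  · refine ⟨⟨_, (hG _ _).mpr ⟨m, hm, n, hn, rfl, rfl⟩⟩, ?_⟩
    ext i j
    fin_cases i <;> fin_cases j <;> simp [Matrix.mul_apply, Fin.sum_univ_three, upperMat] <;> ring

lemma upperSL_div_mem {g : Matrix.SpecialLinearGroup (Fin 3) F} (hg : g ∈ G)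
    (h : (g : Matrix (Fin 3) (Fin 3) F) 0 1 = 0 ∧
      (g : Matrix (Fin 3) (Fin 3) F) 1 0 = 0 ∧ (g : Matrix (Fin 3) (Fin 3) F) 2 0 = 0 ∧
      (g : Matrix (Fin 3) (Fin 3) F) 2 1 = 0) {x y : F} (hxy : upperSL x y ∈ G) :
    upperSL ((g : Matrix (Fin 3) (Fin 3) F) 0 0 * x / (g : Matrix (Fin 3) (Fin 3) F) 2 2)
      ((g : Matrix (Fin 3) (Fin 3) F) 1 1 * y / (g : Matrix (Fin 3) (Fin 3) F) 2 2) ∈ G := by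
  have h2 : (g : Matrix (Fin 3) (Fin 3) F) 2 2 ≠ 0 :=
    right_ne_zero_of_mul (diagonal_prod_eq_one h ▸ one_ne_zero)
  have : upperSL ((g : Matrix (Fin 3) (Fin 3) F) 0 0 * x / (g : Matrix (Fin 3) (Fin 3) F) 2 2)
      ((g : Matrix (Fin 3) (Fin 3) F) 1 1 * y / (g : Matrix (Fin 3) (Fin 3) F) 2 2) =
      g * upperSL x y * g⁻¹ := by
    rw [eq_mul_inv_iff_mul_eq]
    ext i j
    fin_cases i <;> fin_cases j <;>
      simp [Matrix.mul_apply, Fin.sum_univ_three, upperMat, h, h2, add_comm]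
  rw [this]
  exact mul_mem (mul_mem hg hxy) (inv_mem hg)

/-- If the second group of translations is larger than the first, and its direction is not a
coordinate axis, then the two diagonal entries agree. -/
lemma diagonal_eq_of_card_lt [Finite M] (hΔ : a * d - b * c ≠ 0) (hMN : Nat.card M < Nat.card N)
    (hG : ∀ x y, upperSL x y ∈ G ↔ ∃ m ∈ M, ∃ n ∈ N, x = a * m + c * n ∧ y = b * m + d * n)
    (hc : c ≠ 0) (hd : d ≠ 0) {g : Matrix.SpecialLinearGroup (Fin 3) F} (hg : g ∈ G)
    (h : (g : Matrix (Fin 3) (Fin 3) F) 0 1 = 0 ∧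
      (g : Matrix (Fin 3) (Fin 3) F) 1 0 = 0 ∧ (g : Matrix (Fin 3) (Fin 3) F) 2 0 = 0 ∧
      (g : Matrix (Fin 3) (Fin 3) F) 2 1 = 0) :
    (g : Matrix (Fin 3) (Fin 3) F) 0 0 = (g : Matrix (Fin 3) (Fin 3) F) 1 1 := by
  have h2 : (g : Matrix (Fin 3) (Fin 3) F) 2 2 ≠ 0 :=
    right_ne_zero_of_mul (diagonal_prod_eq_one h ▸ one_ne_zero)
  by_contra hne
  let k := ((g : Matrix (Fin 3) (Fin 3) F) 0 0 - (g : Matrix (Fin 3) (Fin 3) F) 1 1) * c * d /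
    ((g : Matrix (Fin 3) (Fin 3) F) 2 2 * (a * d - b * c))
  have hk : k ≠ 0 := div_ne_zero (mul_ne_zero (mul_ne_zero (sub_ne_zero.mpr hne) hc) hd)
    (mul_ne_zero h2 hΔ)
  have hkM (n : N) : k * n ∈ M := by
    obtain ⟨m, hm, n', -, hx, hy⟩ := (hG _ _).mp
      (upperSL_div_mem hg h ((hG (c * n) (d * n)).mpr ⟨0, zero_mem M, n, n.2, by simp⟩))
    convert hm using 1
    rw [div_eq_iff h2] at hx hy
    simp only [k]
    rw [div_mul_eq_mul_div, div_eq_iff (mul_ne_zero h2 hΔ)]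
    linear_combination d * hx - c * hy
  refine hMN.not_ge (Nat.card_le_card_of_injective (fun n : N ↦ (⟨k * n, hkM n⟩ : M))
    fun n n' h ↦ Subtype.ext (mul_left_cancel₀ hk (congrArg Subtype.val h)))

end BlockGroup

/-- Chapter B case 2 with `n₁ < n₂`: the Gorenstein property of `S(V)^G`
is characterised, according to the vanishing of `c` and `d`, by the stated relations between
`λ₁(g) = g 1 1`, `λ₂(g) = g 0 0` and `λ(g) = g 2 2`. -/
theorem stmt11 (p : ℕ) [Fact p.Prime] (F : Type u) [Field F] [CharP F p]
    (G : Subgroup (Matrix.SpecialLinearGroup (Fin 3) F)) [Finite G]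
    (hblock : ∀ g ∈ G, (g : Matrix (Fin 3) (Fin 3) F) 0 1 = 0 ∧
      (g : Matrix (Fin 3) (Fin 3) F) 1 0 = 0 ∧ (g : Matrix (Fin 3) (Fin 3) F) 2 0 = 0 ∧
      (g : Matrix (Fin 3) (Fin 3) F) 2 1 = 0)
    (a b c d : F) (habcd : LinearIndependent F ![![a, b], ![c, d]])
    (n₁ n₂ : ℕ) (hn₁ : 0 < n₁) (hn₂ : 0 < n₂)
    (μ : Fin n₁ → F) (α : Fin n₂ → F)
    (hμ : ∀ e : Fin n₁ → ℕ, ∑ i, (e i : F) * μ i = 0 → ∀ i, (p : ℕ) ∣ e i)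
    (hα : ∀ e : Fin n₂ → ℕ, ∑ j, (e j : F) * α j = 0 → ∀ j, (p : ℕ) ∣ e j)
    (hTG : transSubgroup G = Subgroup.closure
      ({g : Matrix.SpecialLinearGroup (Fin 3) F |
          ∃ i : Fin n₁, (g : Matrix (Fin 3) (Fin 3) F) = upperMat (a * μ i) (b * μ i)} ∪
        {g : Matrix.SpecialLinearGroup (Fin 3) F |
          ∃ j : Fin n₂, (g : Matrix (Fin 3) (Fin 3) F) = upperMat (c * α j) (d * α j)}))
    (hlt : n₁ < n₂) :
    (c ≠ 0 → d ≠ 0 → (IsGorensteinRing ↥(invariantRing G) ↔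
      ∀ g ∈ G, ((g : Matrix (Fin 3) (Fin 3) F) 1 1) ^ (p ^ n₁ + p ^ n₂) *
        (g : Matrix (Fin 3) (Fin 3) F) 2 2 = 1)) ∧
    (c = 0 → d ≠ 0 → (IsGorensteinRing ↥(invariantRing G) ↔
      ∀ g ∈ G, ((g : Matrix (Fin 3) (Fin 3) F) 1 1) ^ (p ^ n₂) *
        ((g : Matrix (Fin 3) (Fin 3) F) 0 0) ^ (p ^ n₁) *
        (g : Matrix (Fin 3) (Fin 3) F) 2 2 = 1)) ∧
    (c ≠ 0 → d = 0 → (IsGorensteinRing ↥(invariantRing G) ↔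
      ∀ g ∈ G, ((g : Matrix (Fin 3) (Fin 3) F) 0 0) ^ (p ^ n₂) *
        ((g : Matrix (Fin 3) (Fin 3) F) 1 1) ^ (p ^ n₁) *
        (g : Matrix (Fin 3) (Fin 3) F) 2 2 = 1)) := by
  have hp : p.Prime := Fact.out
  have hΔ : a * d - b * c ≠ 0 := by
    have := (Matrix.linearIndependent_rows_iff_isUnit (A := !![a, b; c, d])).mp habcd
    rw [Matrix.isUnit_iff_isUnit_det, Matrix.det_fin_two_of] at this
    exact this.ne_zero
  have hM := card_closure_range p hμ
  have hN := card_closure_range p hα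
  have hG := upperSL_mem_iff hTG
  have := Nat.finite_of_card_ne_zero (hM.trans_ne (pow_ne_zero n₁ hp.ne_zero))
  have heq (hc : c ≠ 0) (hd : d ≠ 0) (g) (hg : g ∈ G) :=
    diagonal_eq_of_card_lt hΔ (by rw [hM, hN]; exact Nat.pow_lt_pow_right hp.one_lt hlt) hG hc hd hg
      (hblock g hg)
  obtain ⟨l, hl⟩ := exists_diagonal_characters hblock
  have hd0 (hd : d ≠ 0) : IsGorensteinRing (invariantRing G) ↔
      ∀ g ∈ G, ((g : Matrix (Fin 3) (Fin 3) F) 1 1) ^ (p ^ n₂) *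
        ((g : Matrix (Fin 3) (Fin 3) F) 0 0) ^ (p ^ n₁) *
        (g : Matrix (Fin 3) (Fin 3) F) 2 2 = 1 := by
    have hc (g : G) : c * (g : Matrix (Fin 3) (Fin 3) F) 1 1 =
        c * (g : Matrix (Fin 3) (Fin 3) F) 0 0 := by
      by_cases hc : c = 0
      · rw [hc, zero_mul, zero_mul]
      · rw [heq hc hd g g.2]
    rw [isGorensteinRing_invariantRing_iff_of_characters p hblock hΔ hM hN hG (χ₀ := l 0)
      (χ₁ := l 1) (χ₂ := l 2) (s := fun g ↦ b * ((g : Matrix (Fin 3) (Fin 3) F) 1 1 -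
        (g : Matrix (Fin 3) (Fin 3) F) 0 0) / d) (hl 2) (fun g ↦ by rw [hl, mul_comm])
      (fun g ↦ by rw [hl, hc, mul_comm]) (fun g ↦ by rw [hl, div_mul_cancel₀ _ hd])
      (fun g ↦ by
        rw [hl, sub_self, mul_zero, div_mul_eq_mul_div, div_eq_zero_iff]
        left
        linear_combination b * hc g)
      (fun g ↦ by rw [hl, hl])
      (fun g h0 h1 ↦ ⟨by rw [← hl, h0, Units.val_one], by rw [← hl, h1, Units.val_one]⟩),
      Subtype.forall]
    refine forall₂_congr fun g hg ↦ ?_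
    rw [hl, hl, hl, mul_comm (_ ^ p ^ n₁)]
  refine ⟨fun hc hd ↦ ?_, fun _ hd ↦ hd0 hd, fun hc hd ↦ ?_⟩
  · rw [hd0 hd]
    refine forall₂_congr fun g hg ↦ ?_
    rw [heq hc hd g hg, pow_add, mul_comm (_ ^ p ^ n₁)]
  · rw [isGorensteinRing_invariantRing_iff_of_characters p hblock hΔ hM hN hG (χ₀ := l 1)
      (χ₁ := l 0) (χ₂ := l 2) (s := fun g ↦ a * ((g : Matrix (Fin 3) (Fin 3) F) 0 0 -
        (g : Matrix (Fin 3) (Fin 3) F) 1 1) / c) (hl 2) (fun g ↦ by simp [hd])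
      (fun g ↦ by rw [hl, mul_comm]) (fun g ↦ by simp [hl, hd])
      (fun g ↦ by rw [hl, div_mul_cancel₀ _ hc]) (fun g ↦ by rw [hl, hl, mul_comm])
      (fun g h0 h1 ↦ ⟨by rw [← hl, h1, Units.val_one], by rw [← hl, h0, Units.val_one]⟩),
      Subtype.forall]
    refine forall₂_congr fun g hg ↦ ?_
    rw [hl, hl, hl, mul_comm (_ ^ p ^ n₁)]

end
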